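/- arXiv:1402.0069 — 8 statements merged into one kernel-verified Lean document; each statement's English description precedes it below -/
import Mathlib

section
/- Let m be a positive integer, τ ∈ ℝ with τ ≠ 0 and τ ≠ 1, and let P be an m×m Hermitian positive definite complex matrix. Define F_τ(P) := tr[(1/(τ(τ−1)))P^τ − (1/(τ−1))P] + m/τ, where P^τ denotes the matrix power of P given by the continuous functional calculus (spectral calculus). Then F_τ(P) ≥ 0, and F_τ(P) = 0 if and only if P = I. -/
open Matrix
open scoped Classical ComplexOrder

/-- Real power of a matrix via the spectral calculus (junk value `0` if not Hermitian). -/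
noncomputable def mPow {n : ℕ} (A : Matrix (Fin n) (Fin n) ℂ) (τ : ℝ) :
    Matrix (Fin n) (Fin n) ℂ :=
  if hA : A.IsHermitian then
    (hA.eigenvectorUnitary : Matrix (Fin n) (Fin n) ℂ) *
      Matrix.diagonal (fun i => ((hA.eigenvalues i ^ τ : ℝ) : ℂ)) *
      (star hA.eigenvectorUnitary : Matrix (Fin n) (Fin n) ℂ)
  else 0

/-- The mismatch function `F_τ(P) = tr[(1/(τ(τ−1)))·P^τ − (1/(τ−1))·P] + m/τ`. -/
noncomputable def Ftau {m : ℕ} (τ : ℝ) (P : Matrix (Fin m) (Fin m) ℂ) : ℝ :=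
  (Matrix.trace ((1 / (τ * (τ - 1)) : ℝ) • mPow P τ - (1 / (τ - 1) : ℝ) • P)).re + m / τ

/-- The scalar function whose sum over the eigenvalues is the mismatch function. -/
noncomputable def scalarMismatch (τ x : ℝ) : ℝ :=
  1 / (τ * (τ - 1)) * x ^ τ - 1 / (τ - 1) * x + 1 / τ

lemma scalarMismatch_eq {τ : ℝ} (hτ0 : τ ≠ 0) (hτ1 : τ ≠ 1) (x : ℝ) :
    scalarMismatch τ x = (x ^ τ - (1 + τ * (x - 1))) / (τ * (τ - 1)) := by
  have : τ - 1 ≠ 0 := sub_ne_zero.mpr hτ1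
  unfold scalarMismatch
  field_simp
  ring

lemma scalarMismatch_one {τ : ℝ} (hτ0 : τ ≠ 0) (hτ1 : τ ≠ 1) : scalarMismatch τ 1 = 0 := by
  simp [scalarMismatch_eq hτ0 hτ1]

lemma scalarMismatch_pos {τ x : ℝ} (hτ0 : τ ≠ 0) (hτ1 : τ ≠ 1) (hx : 0 < x) (hx1 : x ≠ 1) :
    0 < scalarMismatch τ x := by
  have hs : -1 ≤ x - 1 := by linarith
  have hs0 : x - 1 ≠ 0 := sub_ne_zero.mpr hx1
  rw [scalarMismatch_eq hτ0 hτ1]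
  rcases lt_or_gt_of_ne hτ0 with h0 | h0
  · refine div_pos ?_ (mul_pos_of_neg_of_neg h0 (by linarith))
    have hlog : Real.log x < x - 1 := Real.log_lt_sub_one_of_pos hx hx1
    have hexp : Real.log x * τ + 1 ≤ x ^ τ := by
      rw [Real.rpow_def_of_pos hx]
      exact Real.add_one_le_exp _
    nlinarith [mul_lt_mul_of_neg_left hlog h0]
  rcases lt_or_gt_of_ne hτ1 with h1 | h1
  · have h := rpow_one_add_lt_one_add_mul_self hs hs0 h0 h1
    rw [add_sub_cancel] at h
    exact div_pos_of_neg_of_neg (by linarith) (mul_neg_of_pos_of_neg h0 (by linarith))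
  · have h := one_add_mul_self_lt_rpow_one_add hs hs0 h1
    rw [add_sub_cancel] at h
    exact div_pos (by linarith) (mul_pos h0 (by linarith))

lemma scalarMismatch_nonneg {τ x : ℝ} (hτ0 : τ ≠ 0) (hτ1 : τ ≠ 1) (hx : 0 < x) :
    0 ≤ scalarMismatch τ x := by
  rcases eq_or_ne x 1 with rfl | h
  · exact (scalarMismatch_one hτ0 hτ1).ge
  · exact (scalarMismatch_pos hτ0 hτ1 hx h).le

lemma scalarMismatch_eq_zero_iff {τ x : ℝ} (hτ0 : τ ≠ 0) (hτ1 : τ ≠ 1) (hx : 0 < x) :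
    scalarMismatch τ x = 0 ↔ x = 1 := by
  refine ⟨fun h => ?_, fun h => h ▸ scalarMismatch_one hτ0 hτ1⟩
  by_contra h1
  exact (scalarMismatch_pos hτ0 hτ1 hx h1).ne' h

lemma trace_mPow {n : ℕ} {A : Matrix (Fin n) (Fin n) ℂ} (hA : A.IsHermitian) (τ : ℝ) :
    (mPow A τ).trace = ∑ i, ((hA.eigenvalues i ^ τ : ℝ) : ℂ) := by
  rw [mPow, dif_pos hA, Matrix.trace_mul_cycle, Unitary.coe_star_mul_self,
    one_mul, Matrix.trace_diagonal]

lemma Ftau_eq_sum {m : ℕ} {P : Matrix (Fin m) (Fin m) ℂ} (hP : P.IsHermitian) (τ : ℝ) :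
    Ftau τ P = ∑ i, scalarMismatch τ (hP.eigenvalues i) := by
  have hre : (∑ i, ((hP.eigenvalues i : ℝ) : ℂ)).re = ∑ i, hP.eigenvalues i := by
    simp [Complex.re_sum]
  have htr : P.trace.re = ∑ i, hP.eigenvalues i := by
    rw [← hre]
    exact congrArg Complex.re hP.trace_eq_sum_eigenvalues
  have hpow : (mPow P τ).trace.re = ∑ i, hP.eigenvalues i ^ τ := by
    rw [trace_mPow hP, Complex.re_sum]
    simp only [Complex.ofReal_re]
  rw [Ftau, Matrix.trace_sub, Matrix.trace_smul, Matrix.trace_smul, Complex.sub_re,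
    Complex.smul_re, Complex.smul_re, htr, hpow]
  simp only [scalarMismatch, Finset.sum_add_distrib, Finset.sum_sub_distrib, ← Finset.mul_sum,
    Finset.sum_const, Finset.card_univ, Fintype.card_fin, nsmul_eq_mul, smul_eq_mul]
  ring

lemma Matrix.IsHermitian.eigenvalues_eq_one_iff {m : ℕ} {P : Matrix (Fin m) (Fin m) ℂ}
    (hP : P.IsHermitian) : (∀ i, hP.eigenvalues i = 1) ↔ P = 1 := by
  constructor
  · intro h
    rw [hP.spectral_theorem, show hP.eigenvalues = fun _ => 1 from funext h]
    have : Matrix.diagonal ((RCLike.ofReal : ℝ → ℂ) ∘ fun _ : Fin m => (1 : ℝ)) = 1 := by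
      ext i j
      simp [Matrix.diagonal_apply, Matrix.one_apply]
    rw [this, map_one]
  · rintro h i
    have hi := hP.eigenvalues_mem_spectrum_real i
    have : Nontrivial (Matrix (Fin m) (Fin m) ℂ) := by
      have : Nonempty (Fin m) := ⟨i⟩
      infer_instance
    generalize hP.eigenvalues i = x at hi ⊢
    rw [h, spectrum.one_eq] at hi
    exact hi

/-- For `τ ∈ ℝ \ {0,1}` and an `m×m` Hermitian positive definite `P`,
`F_τ(P) ≥ 0` with equality iff `P = I`. -/
theorem Ftau_nonneg_eq_zero_iff {m : ℕ} (hm : 0 < m) (τ : ℝ) (hτ0 : τ ≠ 0) (hτ1 : τ ≠ 1)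
    (P : Matrix (Fin m) (Fin m) ℂ) (hP : P.PosDef) :
    0 ≤ Ftau τ P ∧ (Ftau τ P = 0 ↔ P = 1) := by
  have hnn : ∀ i ∈ Finset.univ, 0 ≤ scalarMismatch τ (hP.isHermitian.eigenvalues i) :=
    fun i _ => scalarMismatch_nonneg hτ0 hτ1 (hP.eigenvalues_pos i)
  rw [Ftau_eq_sum hP.isHermitian]
  refine ⟨Finset.sum_nonneg hnn, ?_⟩
  rw [Finset.sum_eq_zero_iff_of_nonneg hnn, ← hP.isHermitian.eigenvalues_eq_one_iff]
  simp only [Finset.mem_univ, true_implies,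
    scalarMismatch_eq_zero_iff hτ0 hτ1 (hP.eigenvalues_pos _)]
end

section
/- Let m be a positive integer, τ ∈ (0,1), Q an m×m Hermitian positive definite complex matrix, and L an invertible m×m matrix with L·L* = Q. Define D_T^{(τ)}(P‖Q) := tr[(1/(τ(τ−1)))(L⁻¹ P L⁻*)^τ − (1/(τ−1)) P Q⁻¹] + m/τ for Hermitian positive definite P. Then P ↦ D_T^{(τ)}(P‖Q) is strictly convex on the set of m×m Hermitian positive definite matrices: for all Hermitian positive definite P₀ ≠ P₁ and all λ ∈ (0,1), D_T^{(τ)}(λP₀ + (1−λ)P₁‖Q) < λ·D_T^{(τ)}(P₀‖Q) + (1−λ)·D_T^{(τ)}(P₁‖Q). -/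
open Matrix
open scoped Classical ComplexOrder

/-- The matrix divergence `D_T^{(τ)}(P‖Q)` computed with the factor `L` of `Q = L·L*`:
`tr[(1/(τ(τ−1)))(L⁻¹ P L⁻*)^τ − (1/(τ−1)) P Q⁻¹] + m/τ`. -/
noncomputable def Dtau {m : ℕ} (τ : ℝ) (P Q L : Matrix (Fin m) (Fin m) ℂ) : ℝ :=
  (Matrix.trace ((1 / (τ * (τ - 1)) : ℝ) • mPow (L⁻¹ * P * (Lᴴ)⁻¹) τ -
      (1 / (τ - 1) : ℝ) • (P * Q⁻¹))).re + m / τ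

/-- The tangent-line bound for the strictly concave function `x ↦ x ^ τ`. -/
lemma rpow_lt_tangent {τ a c : ℝ} (hτ : τ ∈ Set.Ioo (0 : ℝ) 1) (ha : 0 < a) (hc : 0 < c)
    (hac : a ≠ c) : a ^ τ < c ^ τ + τ * c ^ (τ - 1) * (a - c) := by
  have h := rpow_one_add_lt_one_add_mul_self (s := a / c - 1) (p := τ)
    (by have := div_pos ha hc; linarith)
    (by rw [sub_ne_zero]; intro h; exact hac ((div_eq_one_iff_eq hc.ne').mp h)) hτ.1 hτ.2
  rw [add_sub_cancel, Real.div_rpow ha.le hc.le,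
    div_lt_iff₀ (Real.rpow_pos_of_pos hc τ)] at h
  refine h.trans_eq ?_
  rw [Real.rpow_sub_one hc.ne']
  field_simp

lemma rpow_le_tangent {τ a c : ℝ} (hτ : τ ∈ Set.Ioo (0 : ℝ) 1) (ha : 0 < a) (hc : 0 < c) :
    a ^ τ ≤ c ^ τ + τ * c ^ (τ - 1) * (a - c) := by
  by_cases h : a = c
  · simp [h]
  · exact (rpow_lt_tangent hτ ha hc h).le

/-- The matrix with eigenvalues `d` in the orthonormal basis given by the columns of `U`. -/
noncomputable def unitaryConj {n : ℕ} (U : unitaryGroup (Fin n) ℂ) (d : Fin n → ℝ) :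
    Matrix (Fin n) (Fin n) ℂ :=
  (U : Matrix (Fin n) (Fin n) ℂ) * diagonal (fun i => (d i : ℂ)) *
    (star U : Matrix (Fin n) (Fin n) ℂ)

lemma unitaryConj_one {n : ℕ} (U : unitaryGroup (Fin n) ℂ) :
    unitaryConj U (fun _ => 1) = 1 := by
  simp [unitaryConj]

lemma unitaryConj_mul {n : ℕ} (U : unitaryGroup (Fin n) ℂ) (d e : Fin n → ℝ) :
    unitaryConj U d * unitaryConj U e = unitaryConj U (fun i => d i * e i) := by
  have h : (star U : Matrix (Fin n) (Fin n) ℂ) * (U : Matrix (Fin n) (Fin n) ℂ) = 1 := by simp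
  simp only [unitaryConj]
  calc _ = (U : Matrix (Fin n) (Fin n) ℂ) * diagonal (fun i => (d i : ℂ)) *
        ((star U : Matrix (Fin n) (Fin n) ℂ) * (U : Matrix (Fin n) (Fin n) ℂ)) *
        diagonal (fun i => (e i : ℂ)) * (star U : Matrix (Fin n) (Fin n) ℂ) := by
        simp only [Matrix.mul_assoc]
    _ = _ := by
        rw [h, Matrix.mul_one, Matrix.mul_assoc _ (diagonal _) (diagonal _), diagonal_mul_diagonal]
        simp

lemma trace_unitaryConj_mul {n : ℕ} (U V : unitaryGroup (Fin n) ℂ) (d e : Fin n → ℝ) :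
    (trace (unitaryConj U d * unitaryConj V e)).re =
      ∑ i, ∑ j, Complex.normSq
        (((star U : Matrix (Fin n) (Fin n) ℂ) * (V : Matrix (Fin n) (Fin n) ℂ)) i j) *
          (d i * e j) := by
  set W := (star U : Matrix (Fin n) (Fin n) ℂ) * (V : Matrix (Fin n) (Fin n) ℂ) with hW
  have h : trace (unitaryConj U d * unitaryConj V e) =
      trace (diagonal (fun i => (d i : ℂ)) * W * (diagonal (fun i => (e i : ℂ)) * Wᴴ)) := by
    have hWs : Wᴴ = (star V : Matrix (Fin n) (Fin n) ℂ) * (U : Matrix (Fin n) (Fin n) ℂ) := by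
      rw [hW, conjTranspose_mul, star_eq_conjTranspose, star_eq_conjTranspose,
        conjTranspose_conjTranspose]
    rw [hWs, hW, unitaryConj, unitaryConj]
    simp only [Matrix.mul_assoc]
    rw [trace_mul_comm]
    simp only [Matrix.mul_assoc]
  rw [h, trace, Complex.re_sum]
  refine Finset.sum_congr rfl fun i _ => ?_
  rw [diag_apply, Matrix.mul_apply, Complex.re_sum]
  refine Finset.sum_congr rfl fun j _ => ?_
  rw [diagonal_mul, diagonal_mul, conjTranspose_apply]
  simp [Complex.normSq_apply]
  ring

lemma Matrix.IsHermitian.eq_unitaryConj {n : ℕ} {A : Matrix (Fin n) (Fin n) ℂ}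
    (hA : A.IsHermitian) : A = unitaryConj hA.eigenvectorUnitary hA.eigenvalues := by
  conv_lhs => rw [hA.spectral_theorem]
  rfl

lemma Matrix.IsHermitian.mPow_eq {n : ℕ} {A : Matrix (Fin n) (Fin n) ℂ}
    (hA : A.IsHermitian) (τ : ℝ) :
    mPow A τ = unitaryConj hA.eigenvectorUnitary (fun i => hA.eigenvalues i ^ τ) := by
  rw [mPow, dif_pos hA, unitaryConj]

/-- Klein's inequality for `x ↦ x ^ τ`, with its equality case: the trace of the power lies
below its tangent at `C`, strictly so away from `C`. -/
lemma exists_trace_mPow_lt {n : ℕ} {τ : ℝ} (hτ : τ ∈ Set.Ioo (0 : ℝ) 1)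
    {C : Matrix (Fin n) (Fin n) ℂ} (hC : C.PosDef) :
    ∃ G : Matrix (Fin n) (Fin n) ℂ, ∀ A : Matrix (Fin n) (Fin n) ℂ, A.PosDef → A ≠ C →
      (trace (mPow A τ)).re < (trace (mPow C τ)).re + (trace ((A - C) * G)).re := by
  set V := hC.1.eigenvectorUnitary
  set c := hC.1.eigenvalues
  refine ⟨unitaryConj V (fun j => τ * c j ^ (τ - 1)), fun A hA hne => ?_⟩
  set U := hA.1.eigenvectorUnitary
  set a := hA.1.eigenvalues
  have hAU : A = unitaryConj U a := hA.1.eq_unitaryConj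
  have hCV : C = unitaryConj V c := hC.1.eq_unitaryConj
  set w : Fin n → Fin n → ℝ := fun i j => Complex.normSq
    (((star U : Matrix (Fin n) (Fin n) ℂ) * (V : Matrix (Fin n) (Fin n) ℂ)) i j)
  have hw : ∀ i j, 0 ≤ w i j := fun i j => Complex.normSq_nonneg _
  have key : ∀ d e : Fin n → ℝ, (trace (unitaryConj U d * unitaryConj V e)).re =
      ∑ i, ∑ j, w i j * (d i * e j) := trace_unitaryConj_mul U V
  have keyL : ∀ d : Fin n → ℝ, (trace (unitaryConj U d)).re = ∑ i, ∑ j, w i j * d i := by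
    intro d
    simpa [unitaryConj_one] using key d (fun _ => 1)
  have keyR : ∀ e : Fin n → ℝ, (trace (unitaryConj V e)).re = ∑ i, ∑ j, w i j * e j := by
    intro e
    simpa [unitaryConj_one] using key (fun _ => 1) e
  have hsq : (trace ((A - C) * (A - C))).re = ∑ i, ∑ j, w i j * (a i - c j) ^ 2 := by
    have h : trace ((A - C) * (A - C)) =
        trace (A * A) - trace (A * C) - trace (A * C) + trace (C * C) := by
      simp only [Matrix.sub_mul, Matrix.mul_sub, trace_sub, trace_mul_comm C A]
      ring
    rw [h, hAU, hCV, unitaryConj_mul, unitaryConj_mul]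
    simp only [Complex.add_re, Complex.sub_re, key, keyL, keyR, ← Finset.sum_sub_distrib,
      ← Finset.sum_add_distrib]
    refine Finset.sum_congr rfl fun i _ => Finset.sum_congr rfl fun j _ => by ring
  obtain ⟨i₀, j₀, hw₀, hac⟩ : ∃ i j, 0 < w i j ∧ a i ≠ c j := by
    by_contra! hcon
    refine hne (sub_eq_zero.mp ?_)
    have hH : (A - C)ᴴ = A - C := (hA.1.sub hC.1)
    have hz : (trace ((A - C) * (A - C))).re = 0 := by
      rw [hsq]
      refine Finset.sum_eq_zero fun i _ => Finset.sum_eq_zero fun j _ => ?_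
      rcases (hw i j).eq_or_lt with h | h
      · rw [← h, zero_mul]
      · rw [hcon i j h, sub_self]; ring
    have hp := (posSemidef_conjTranspose_mul_self (A - C)).trace_nonneg
    rw [← trace_conjTranspose_mul_self_eq_zero_iff]
    have him := (Complex.le_def.mp hp).2
    rw [hH] at him ⊢
    exact Complex.ext hz him.symm
  have hG : (trace (mPow C τ)).re +
      (trace ((A - C) * unitaryConj V (fun j => τ * c j ^ (τ - 1)))).re =
      ∑ i, ∑ j, w i j * (c j ^ τ + τ * c j ^ (τ - 1) * (a i - c j)) := by
    have hCG : C * unitaryConj V (fun j => τ * c j ^ (τ - 1)) =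
        unitaryConj V (fun j => c j * (τ * c j ^ (τ - 1))) :=
      (congrArg (· * unitaryConj V _) hCV).trans (unitaryConj_mul V c _)
    rw [Matrix.sub_mul, trace_sub, hCG, hAU, hC.1.mPow_eq, Complex.sub_re, keyR, keyR, key]
    simp only [← Finset.sum_sub_distrib, ← Finset.sum_add_distrib]
    refine Finset.sum_congr rfl fun i _ => Finset.sum_congr rfl fun j _ => by ring
  rw [hG, hA.1.mPow_eq, keyL]
  have hle : ∀ i j, w i j * a i ^ τ ≤
      w i j * (c j ^ τ + τ * c j ^ (τ - 1) * (a i - c j)) := fun i j =>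
    mul_le_mul_of_nonneg_left (rpow_le_tangent hτ (hA.eigenvalues_pos i) (hC.eigenvalues_pos j))
      (hw i j)
  refine Finset.sum_lt_sum (fun i _ => Finset.sum_le_sum fun j _ => hle i j)
    ⟨i₀, Finset.mem_univ _, Finset.sum_lt_sum (fun j _ => hle i₀ j) ⟨j₀, Finset.mem_univ _, ?_⟩⟩
  exact mul_lt_mul_of_pos_left
    (rpow_lt_tangent hτ (hA.eigenvalues_pos i₀) (hC.eigenvalues_pos j₀) hac) hw₀

/-- Strict concavity of `A ↦ tr (A ^ τ)` on positive definite matrices. -/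
lemma trace_mPow_strictConcave {n : ℕ} {τ : ℝ} (hτ : τ ∈ Set.Ioo (0 : ℝ) 1)
    {A B : Matrix (Fin n) (Fin n) ℂ} (hA : A.PosDef) (hB : B.PosDef) (hne : A ≠ B)
    {lam : ℝ} (hlam : lam ∈ Set.Ioo (0 : ℝ) 1) :
    lam * (trace (mPow A τ)).re + (1 - lam) * (trace (mPow B τ)).re <
      (trace (mPow (lam • A + (1 - lam) • B) τ)).re := by
  have h1 : 0 < 1 - lam := sub_pos.mpr hlam.2
  have hC : (lam • A + (1 - lam) • B).PosDef := (hA.smul hlam.1).add (hB.smul h1)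
  have hsubA : A - (lam • A + (1 - lam) • B) = (1 - lam) • (A - B) := by module
  have hsubB : B - (lam • A + (1 - lam) • B) = (-lam) • (A - B) := by module
  obtain ⟨G, hG⟩ := exists_trace_mPow_lt hτ hC
  have hGA := hG A hA (by
    rw [← sub_ne_zero, hsubA]; exact smul_ne_zero h1.ne' (sub_ne_zero.mpr hne))
  have hGB := hG B hB (by
    rw [← sub_ne_zero, hsubB]
    exact smul_ne_zero (neg_ne_zero.mpr hlam.1.ne') (sub_ne_zero.mpr hne))
  rw [hsubA, Matrix.smul_mul, trace_smul, Complex.smul_re, smul_eq_mul] at hGA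
  rw [hsubB, Matrix.smul_mul, trace_smul, Complex.smul_re, smul_eq_mul] at hGB
  have h2 := mul_lt_mul_of_pos_left hGA hlam.1
  have h3 := mul_lt_mul_of_pos_left hGB h1
  linarith

/-- For `τ ∈ (0,1)`, `Q` Hermitian positive definite and `L` an invertible
factor with `L·L* = Q`, the map `P ↦ D_T^{(τ)}(P‖Q)` is strictly convex on the Hermitian
positive definite matrices. -/
theorem Dtau_strictConvex {m : ℕ} (hm : 0 < m) (τ : ℝ) (hτ : τ ∈ Set.Ioo (0 : ℝ) 1)
    (Q L : Matrix (Fin m) (Fin m) ℂ) (hQ : Q.PosDef)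
    (hL : IsUnit L.det) (hLQ : L * Lᴴ = Q)
    (P₀ P₁ : Matrix (Fin m) (Fin m) ℂ) (hP₀ : P₀.PosDef) (hP₁ : P₁.PosDef)
    (hne : P₀ ≠ P₁) (lam : ℝ) (hlam : lam ∈ Set.Ioo (0 : ℝ) 1) :
    Dtau τ (lam • P₀ + (1 - lam) • P₁) Q L < lam * Dtau τ P₀ Q L + (1 - lam) * Dtau τ P₁ Q L := by
  have hLi : IsUnit (L⁻¹).det := (isUnit_nonsing_inv_det_iff).mpr hL
  have hcong : ∀ P : Matrix (Fin m) (Fin m) ℂ, P.PosDef → (L⁻¹ * P * (Lᴴ)⁻¹).PosDef := by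
    intro P hP
    rw [← conjTranspose_nonsing_inv]
    exact hP.mul_mul_conjTranspose_same
      (vecMul_injective_of_isUnit ((isUnit_iff_isUnit_det _).mpr hLi))
  have hne' : L⁻¹ * P₀ * (Lᴴ)⁻¹ ≠ L⁻¹ * P₁ * (Lᴴ)⁻¹ := by
    intro h
    have hinv : ∀ P : Matrix (Fin m) (Fin m) ℂ, L * (L⁻¹ * P * (Lᴴ)⁻¹) * Lᴴ = P := by
      intro P
      have hLH : IsUnit (Lᴴ).det := by rw [det_conjTranspose]; exact hL.star
      rw [Matrix.mul_assoc L⁻¹, mul_nonsing_inv_cancel_left _ _ hL,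
        nonsing_inv_mul_cancel_right _ _ hLH]
    exact hne (by rw [← hinv P₀, h, hinv P₁])
  have hconc := trace_mPow_strictConcave hτ (hcong P₀ hP₀) (hcong P₁ hP₁) hne' hlam
  have hlin : L⁻¹ * (lam • P₀ + (1 - lam) • P₁) * (Lᴴ)⁻¹ =
      lam • (L⁻¹ * P₀ * (Lᴴ)⁻¹) + (1 - lam) • (L⁻¹ * P₁ * (Lᴴ)⁻¹) := by
    simp only [Matrix.mul_add, Matrix.add_mul, Matrix.mul_smul, Matrix.smul_mul]
  have hneg : 1 / (τ * (τ - 1)) < 0 :=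
    one_div_neg.mpr (mul_neg_of_pos_of_neg hτ.1 (sub_neg.mpr hτ.2))
  have hmul := mul_lt_mul_of_neg_left hconc hneg
  simp only [Dtau, hlin, Matrix.add_mul, Matrix.smul_mul, trace_sub, trace_add, trace_smul,
    Complex.sub_re, Complex.add_re, Complex.smul_re, smul_eq_mul]
  linarith
end

section
/- Let m be a positive integer, let P and Q be m×m Hermitian positive definite complex matrices, and let L be any invertible m×m matrix with L·L* = Q. Define D_T^{(τ)}(P‖Q) := tr[(1/(τ(τ−1)))(L⁻¹ P L⁻*)^τ − (1/(τ−1)) P Q⁻¹] + m/τ for τ ∈ ℝ \ {0,1}. Then lim_{τ→0} D_T^{(τ)}(P‖Q) = tr[log Q − log P + P Q⁻¹] − m, where log denotes the matrix logarithm of a Hermitian positive definite matrix via the spectral calculus. -/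
open Matrix Filter
open scoped Classical ComplexOrder Topology

/-- Logarithm of a matrix via the spectral calculus (junk value `0` if not Hermitian). -/
noncomputable def mLog {n : ℕ} (A : Matrix (Fin n) (Fin n) ℂ) :
    Matrix (Fin n) (Fin n) ℂ :=
  if hA : A.IsHermitian then
    (hA.eigenvectorUnitary : Matrix (Fin n) (Fin n) ℂ) *
      Matrix.diagonal (fun i => ((Real.log (hA.eigenvalues i) : ℝ) : ℂ)) *
      (star hA.eigenvectorUnitary : Matrix (Fin n) (Fin n) ℂ)
  else 0

lemma trace_unitary_conj_diagonal {n : ℕ} (U : Matrix.unitaryGroup (Fin n) ℂ) (d : Fin n → ℝ) :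
    (Matrix.trace ((U : Matrix (Fin n) (Fin n) ℂ) * Matrix.diagonal (fun i => (d i : ℂ)) *
      (star U : Matrix (Fin n) (Fin n) ℂ))).re = ∑ i, d i := by
  rw [Matrix.trace_mul_cycle, Unitary.coe_star_mul_self, one_mul, Matrix.trace_diagonal]
  simp

lemma re_trace_mPow {n : ℕ} {A : Matrix (Fin n) (Fin n) ℂ} (hA : A.IsHermitian) (τ : ℝ) :
    (mPow A τ).trace.re = ∑ i, hA.eigenvalues i ^ τ := by
  rw [mPow, dif_pos hA, trace_unitary_conj_diagonal]

lemma re_trace_mLog {n : ℕ} {A : Matrix (Fin n) (Fin n) ℂ} (hA : A.PosDef) :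
    (mLog A).trace.re = Real.log (∏ i, hA.1.eigenvalues i) := by
  rw [mLog, dif_pos hA.1, trace_unitary_conj_diagonal,
    Real.log_prod fun i _ => (hA.eigenvalues_pos i).ne']

lemma tendsto_rpow_sub_one_div {a : ℝ} (ha : 0 < a) :
    Tendsto (fun τ : ℝ => (a ^ τ - 1) / τ) (𝓝[≠] 0) (𝓝 (Real.log a)) := by
  have h := ((hasDerivAt_id (0 : ℝ)).const_rpow ha).tendsto_slope_zero
  simpa [div_eq_inv_mul] using h

lemma posDef_inv_mul_mul_inv {m : ℕ} {P L : Matrix (Fin m) (Fin m) ℂ} (hP : P.PosDef)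
    (hL : IsUnit L.det) : (L⁻¹ * P * (Lᴴ)⁻¹).PosDef := by
  have hU : IsUnit L⁻¹ := (Matrix.isUnit_nonsing_inv_iff).2 ((Matrix.isUnit_iff_isUnit_det L).2 hL)
  rw [← Matrix.conjTranspose_nonsing_inv, ← Matrix.star_eq_conjTranspose]
  exact (Matrix.IsUnit.posDef_star_right_conjugate_iff hU).2 hP

lemma re_trace_mLog_inv_mul_mul_inv {m : ℕ} {P Q L : Matrix (Fin m) (Fin m) ℂ} (hP : P.PosDef)
    (hQ : Q.PosDef) (hL : IsUnit L.det) (hLQ : L * Lᴴ = Q) :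
    (mLog (L⁻¹ * P * (Lᴴ)⁻¹)).trace.re = (mLog P).trace.re - (mLog Q).trace.re := by
  have hA := posDef_inv_mul_mul_inv hP hL
  have hdet : P.det = (L⁻¹ * P * (Lᴴ)⁻¹).det * Q.det := by
    have hL' : Lᴴ.det ≠ 0 := by simpa [Matrix.det_conjTranspose] using hL.ne_zero
    have := hL.ne_zero
    rw [← hLQ]
    simp only [Matrix.det_mul, Matrix.det_nonsing_inv, Ring.inverse_eq_inv']
    field_simp
  rw [hP.1.det_eq_prod_eigenvalues, hQ.1.det_eq_prod_eigenvalues,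
    hA.1.det_eq_prod_eigenvalues] at hdet
  have hprod : ∏ i, hP.1.eigenvalues i =
      (∏ i, hA.1.eigenvalues i) * ∏ i, hQ.1.eigenvalues i := by
    apply Complex.ofReal_injective
    push_cast
    exact hdet
  rw [re_trace_mLog hP, re_trace_mLog hQ, re_trace_mLog hA, hprod, Real.log_mul
    (Finset.prod_pos fun i _ => hA.eigenvalues_pos i).ne'
    (Finset.prod_pos fun i _ => hQ.eigenvalues_pos i).ne']
  ring

lemma Dtau_eq {m : ℕ} {τ : ℝ} (h0 : τ ≠ 0) (h1 : τ ≠ 1) (P Q L : Matrix (Fin m) (Fin m) ℂ)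
    (hA : (L⁻¹ * P * (Lᴴ)⁻¹).IsHermitian) :
    Dtau τ P Q L =
      (∑ i, (hA.eigenvalues i ^ τ - 1) / τ + m - (P * Q⁻¹).trace.re) / (τ - 1) := by
  have h1' : τ - 1 ≠ 0 := sub_ne_zero.2 h1
  rw [Dtau, Matrix.trace_sub, Matrix.trace_smul, Matrix.trace_smul, Complex.sub_re,
    Complex.smul_re, Complex.smul_re, re_trace_mPow hA, ← Finset.sum_div, Finset.sum_sub_distrib]
  simp only [Finset.sum_const, Finset.card_univ, Fintype.card_fin, nsmul_eq_mul, smul_eq_mul]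
  field_simp
  ring

/-- As `τ → 0` (through values `τ ∉ {0,1}`), `D_T^{(τ)}(P‖Q)` converges to the
Burg matrix divergence `tr[log Q − log P + P Q⁻¹] − m`. -/
theorem Dtau_tendsto_zero {m : ℕ} (hm : 0 < m)
    (P Q L : Matrix (Fin m) (Fin m) ℂ) (hP : P.PosDef) (hQ : Q.PosDef)
    (hL : IsUnit L.det) (hLQ : L * Lᴴ = Q) :
    Tendsto (fun τ : ℝ => Dtau τ P Q L) (𝓝[({0, 1} : Set ℝ)ᶜ] 0)
      (𝓝 ((Matrix.trace (mLog Q - mLog P + P * Q⁻¹)).re - m)) := by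
  have hA := posDef_inv_mul_mul_inv hP hL
  have hsum : Tendsto (fun τ : ℝ => ∑ i, (hA.1.eigenvalues i ^ τ - 1) / τ) (𝓝[({0, 1} : Set ℝ)ᶜ] 0)
      (𝓝 (∑ i, Real.log (hA.1.eigenvalues i))) :=
    tendsto_finsetSum _ fun i _ => (tendsto_rpow_sub_one_div (hA.eigenvalues_pos i)).mono_left
      (nhdsWithin_mono _ fun τ hτ => by simp_all)
  have hden : Tendsto (fun τ : ℝ => τ - 1) (𝓝[({0, 1} : Set ℝ)ᶜ] 0) (𝓝 (0 - 1)) :=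
    (tendsto_id.sub_const 1).mono_left nhdsWithin_le_nhds
  have hlim := ((hsum.add_const (m : ℝ)).sub_const (P * Q⁻¹).trace.re).div hden (by norm_num)
  have hlog := re_trace_mLog_inv_mul_mul_inv hP hQ hL hLQ
  rw [re_trace_mLog hA, Real.log_prod fun i _ => (hA.eigenvalues_pos i).ne'] at hlog
  have hval : (Matrix.trace (mLog Q - mLog P + P * Q⁻¹)).re - m =
      (∑ i, Real.log (hA.1.eigenvalues i) + m - (P * Q⁻¹).trace.re) / (0 - 1) := by
    rw [hlog, Matrix.trace_add, Matrix.trace_sub, Complex.add_re, Complex.sub_re]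
    ring
  rw [hval]
  refine hlim.congr' ?_
  filter_upwards [self_mem_nhdsWithin] with τ hτ
  simp only [Set.mem_compl_iff, Set.mem_insert_iff, Set.mem_singleton_iff, not_or] at hτ
  exact (Dtau_eq hτ.1 hτ.2 P Q L hA.1).symm
end

section
/- Let n be a positive integer, c ∈ ℝ, X an n×n Hermitian positive definite complex matrix, and Δ an n×n Hermitian complex matrix. Then the function t ↦ tr[(X + tΔ)^c], defined for real t in a neighborhood of 0 on which X + tΔ is positive definite and with the matrix power taken via the spectral calculus, is differentiable at t = 0 with derivative c · tr[X^{c−1} Δ]. -/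
open Matrix
open scoped Classical ComplexOrder

namespace Matrix

variable {ι : Type*} [Fintype ι] [DecidableEq ι]

/-- The Hermitian matrix with real eigenvalues `a` in the orthonormal basis given by the columns
of `U`. -/
noncomputable def conjDiagonal (U : unitaryGroup ι ℂ) (a : ι → ℝ) : Matrix ι ι ℂ :=
  (U : Matrix ι ι ℂ) * diagonal (fun i => (a i : ℂ)) * (star U : Matrix ι ι ℂ)

/-- The squared overlaps between the columns of two unitary matrices. -/
noncomputable def overlap (U V : unitaryGroup ι ℂ) (i j : ι) : ℝ :=
  Complex.normSq ((star (U : Matrix ι ι ℂ) * (V : Matrix ι ι ℂ)) i j)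

lemma overlap_nonneg (U V : unitaryGroup ι ℂ) (i j : ι) : 0 ≤ overlap U V i j :=
  Complex.normSq_nonneg _

lemma sum_overlap (U V : unitaryGroup ι ℂ) (i : ι) : ∑ j, overlap U V i j = 1 := by
  have h : (star (U : Matrix ι ι ℂ) * (V : Matrix ι ι ℂ)) *
      star (star (U : Matrix ι ι ℂ) * (V : Matrix ι ι ℂ)) = 1 :=
    mem_unitaryGroup_iff.mp (star U * V).2
  have hi := congrArg Complex.re (congrFun (congrFun h i) i)
  simpa [mul_apply (M := star (U : Matrix ι ι ℂ) * (V : Matrix ι ι ℂ)), -star_mul,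
    star_apply, overlap, Complex.normSq_apply] using hi

lemma conjDiagonal_one (U : unitaryGroup ι ℂ) : conjDiagonal U 1 = 1 := by
  simp [conjDiagonal]

lemma conjDiagonal_smul (U : unitaryGroup ι ℂ) (c : ℝ) (a : ι → ℝ) :
    conjDiagonal U (c • a) = (c : ℂ) • conjDiagonal U a := by
  rw [conjDiagonal, conjDiagonal, ← Matrix.smul_mul, ← Matrix.mul_smul, ← diagonal_smul]
  simp [Pi.smul_def]

lemma conjDiagonal_mul (U : unitaryGroup ι ℂ) (a b : ι → ℝ) :
    conjDiagonal U a * conjDiagonal U b = conjDiagonal U (a * b) := by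
  have h : star (U : Matrix ι ι ℂ) * (U : Matrix ι ι ℂ) = 1 := mem_unitaryGroup_iff'.mp U.2
  calc conjDiagonal U a * conjDiagonal U b
      = (U : Matrix ι ι ℂ) * diagonal (fun i => (a i : ℂ)) *
        (star (U : Matrix ι ι ℂ) * (U : Matrix ι ι ℂ)) * diagonal (fun i => (b i : ℂ)) *
        star (U : Matrix ι ι ℂ) := by
        simp only [conjDiagonal, Matrix.mul_assoc]
    _ = conjDiagonal U (a * b) := by
        rw [h, Matrix.mul_one, Matrix.mul_assoc (U : Matrix ι ι ℂ), diagonal_mul_diagonal]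
        simp [conjDiagonal]

lemma re_trace_conjDiagonal_mul (U V : unitaryGroup ι ℂ) (a b : ι → ℝ) :
    (trace (conjDiagonal U a * conjDiagonal V b)).re =
      ∑ i, ∑ j, overlap U V i j * (a i * b j) := by
  set W := star (U : Matrix ι ι ℂ) * (V : Matrix ι ι ℂ) with hW
  have h : trace (conjDiagonal U a * conjDiagonal V b) =
      trace (diagonal (fun i => (a i : ℂ)) * (W * (diagonal (fun i => (b i : ℂ)) * star W))) := by
    simp only [conjDiagonal, hW, star_mul, star_star, Matrix.mul_assoc]
    rw [trace_mul_comm]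
    simp only [Matrix.mul_assoc]
  rw [h]
  simp only [trace, diag_apply, diagonal_mul, mul_apply (M := W), Complex.re_sum, Finset.mul_sum,
    star_apply]
  refine Finset.sum_congr rfl fun i _ => Finset.sum_congr rfl fun j _ => ?_
  simp [overlap, ← hW, Complex.normSq_apply]
  ring

lemma re_trace_conjDiagonal_left (U V : unitaryGroup ι ℂ) (a : ι → ℝ) :
    (trace (conjDiagonal U a)).re = ∑ i, ∑ j, overlap U V i j * a i := by
  simpa [conjDiagonal_one] using re_trace_conjDiagonal_mul U V a 1

lemma re_trace_conjDiagonal_right (U V : unitaryGroup ι ℂ) (b : ι → ℝ) :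
    (trace (conjDiagonal V b)).re = ∑ i, ∑ j, overlap U V i j * b j := by
  simpa [conjDiagonal_one] using re_trace_conjDiagonal_mul U V 1 b

lemma re_trace_sub_mul_sub (U V : unitaryGroup ι ℂ) (a b : ι → ℝ) :
    (trace ((conjDiagonal U a - conjDiagonal V b) * (conjDiagonal U a - conjDiagonal V b))).re =
      ∑ i, ∑ j, overlap U V i j * (a i - b j) ^ 2 := by
  rw [sub_mul, mul_sub, mul_sub, conjDiagonal_mul, conjDiagonal_mul, trace_sub, trace_sub,
    trace_sub, trace_mul_comm (conjDiagonal V b)]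
  simp only [Complex.sub_re]
  rw [re_trace_conjDiagonal_mul, re_trace_conjDiagonal_left U V, re_trace_conjDiagonal_right U V]
  simp only [← Finset.sum_sub_distrib]
  refine Finset.sum_congr rfl fun i _ => Finset.sum_congr rfl fun j _ => ?_
  simp only [Pi.mul_apply]
  ring

lemma re_trace_bregman (U V : unitaryGroup ι ℂ) (a b : ι → ℝ) (f g : ℝ → ℝ) :
    (trace (conjDiagonal U (f ∘ a))).re - (trace (conjDiagonal V (f ∘ b))).re -
        (trace (conjDiagonal V (g ∘ b) * (conjDiagonal U a - conjDiagonal V b))).re =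
      ∑ i, ∑ j, overlap U V i j * (f (a i) - f (b j) - g (b j) * (a i - b j)) := by
  rw [mul_sub, conjDiagonal_mul, trace_sub, trace_mul_comm (conjDiagonal V (g ∘ b)),
    Complex.sub_re, re_trace_conjDiagonal_mul, re_trace_conjDiagonal_left U V,
    re_trace_conjDiagonal_right U V, re_trace_conjDiagonal_right U V]
  simp only [← Finset.sum_sub_distrib]
  refine Finset.sum_congr rfl fun i _ => Finset.sum_congr rfl fun j _ => ?_
  simp only [Pi.mul_apply, Function.comp_apply]
  ring

/-- Every eigenvalue of a Hermitian matrix is close to one of a nearby Hermitian matrix. -/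
lemma exists_sq_sub_le_re_trace (U V : unitaryGroup ι ℂ) (a b : ι → ℝ) (i : ι) :
    ∃ j, (a i - b j) ^ 2 ≤
      (trace ((conjDiagonal U a - conjDiagonal V b) *
        (conjDiagonal U a - conjDiagonal V b))).re := by
  rw [re_trace_sub_mul_sub]
  set D := ∑ i, ∑ j, overlap U V i j * (a i - b j) ^ 2
  have hnn : ∀ k l, 0 ≤ overlap U V k l * (a k - b l) ^ 2 := fun k l =>
    mul_nonneg (overlap_nonneg U V k l) (sq_nonneg _)
  have hi : ∑ j, overlap U V i j * (a i - b j) ^ 2 ≤ D :=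
    Finset.single_le_sum (f := fun k => ∑ j, overlap U V k j * (a k - b j) ^ 2)
      (fun k _ => Finset.sum_nonneg fun l _ => hnn k l) (Finset.mem_univ i)
  by_contra! hlt
  have hpos : ∃ j ∈ Finset.univ, 0 < overlap U V i j := by
    by_contra! hle
    have := Finset.sum_nonpos hle
    rw [sum_overlap] at this
    linarith
  obtain ⟨j₀, -, hj₀⟩ := hpos
  have : ∑ j, overlap U V i j * D < ∑ j, overlap U V i j * (a i - b j) ^ 2 :=
    Finset.sum_lt_sum (fun j _ => mul_le_mul_of_nonneg_left (hlt j).le (overlap_nonneg U V i j))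
      ⟨j₀, Finset.mem_univ _, mul_lt_mul_of_pos_left (hlt j₀) hj₀⟩
  rw [← Finset.sum_mul, sum_overlap, one_mul] at this
  linarith

lemma IsHermitian.eq_conjDiagonal {A : Matrix ι ι ℂ} (hA : A.IsHermitian) :
    A = conjDiagonal hA.eigenvectorUnitary hA.eigenvalues :=
  hA.spectral_theorem.trans (Unitary.conjStarAlgAut_apply _ _)

end Matrix

/-- A uniform second-order Taylor bound for real powers on a compact subinterval of `(0, ∞)`. -/
lemma Real.exists_abs_rpow_sub_le (c : ℝ) {m M : ℝ} (hm : 0 < m) :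
    ∃ K, ∀ x ∈ Set.Icc m M, ∀ y ∈ Set.Icc m M,
      |x ^ c - y ^ c - c * y ^ (c - 1) * (x - y)| ≤ K * (x - y) ^ 2 := by
  have hne : ∀ z ∈ Set.Icc m M, z ≠ 0 := fun z hz => (hm.trans_le hz.1).ne'
  have hcont : ContinuousOn (fun z : ℝ => c * ((c - 1) * z ^ (c - 1 - 1))) (Set.Icc m M) :=
    continuousOn_const.mul (continuousOn_const.mul
      (continuousOn_id.rpow_const fun z hz => Or.inl (hne z hz)))
  obtain ⟨K, hK⟩ := isCompact_Icc.exists_bound_of_continuousOn hcont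
  have hd : ∀ (p : ℝ), ∀ z ∈ Set.Icc m M, HasDerivAt (fun w : ℝ => w ^ p) (p * z ^ (p - 1)) z :=
    fun p z hz => Real.hasDerivAt_rpow_const (Or.inl (hne z hz))
  refine ⟨max K 0, fun x hx y hy => ?_⟩
  have hlip : ∀ z ∈ Set.Icc m M,
      |c * z ^ (c - 1) - c * y ^ (c - 1)| ≤ max K 0 * |z - y| := fun z hz =>
    (convex_Icc m M).norm_image_sub_le_of_norm_hasDerivWithin_le
      (f := fun w : ℝ => c * w ^ (c - 1))
      (fun w hw => ((hd (c - 1) w hw).const_mul c).hasDerivWithinAt)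
      (fun w hw => (hK w hw).trans (le_max_left _ _)) hy hz
  have hsub : Set.uIcc y x ⊆ Set.Icc m M := Set.uIcc_subset_Icc hy hx
  have hbound := (convex_uIcc y x).norm_image_sub_le_of_norm_hasDerivWithin_le
    (f := fun w : ℝ => w ^ c - c * y ^ (c - 1) * w) (C := max K 0 * |x - y|)
    (f' := fun w => c * w ^ (c - 1) - c * y ^ (c - 1))
    (fun w hw => ((hd c w (hsub hw)).sub
      ((hasDerivAt_id w).const_mul (c * y ^ (c - 1)) |>.congr_deriv (mul_one _))).hasDerivWithinAt)
    (fun w hw => (hlip w (hsub hw)).trans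
      (mul_le_mul_of_nonneg_left (Set.abs_sub_left_of_mem_uIcc hw) (le_max_right _ _)))
    Set.left_mem_uIcc Set.right_mem_uIcc
  simp only [Real.norm_eq_abs] at hbound
  calc _ = |x ^ c - c * y ^ (c - 1) * x - (y ^ c - c * y ^ (c - 1) * y)| := by ring_nf
    _ ≤ max K 0 * |x - y| * |x - y| := hbound
    _ = max K 0 * (x - y) ^ 2 := by rw [mul_assoc, ← sq, sq_abs]

lemma mPow_eq_conjDiagonal {n : ℕ} {A : Matrix (Fin n) (Fin n) ℂ} (hA : A.IsHermitian) (τ : ℝ) :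
    mPow A τ = conjDiagonal hA.eigenvectorUnitary ((fun x : ℝ => x ^ τ) ∘ hA.eigenvalues) :=
  dif_pos hA

/-- for Hermitian positive definite `X`, Hermitian `Δ` and `c ∈ ℝ`, the map
`t ↦ tr[(X + tΔ)^c]` is differentiable at `t = 0` with derivative `c·tr[X^{c−1} Δ]`. -/
theorem hasDerivAt_trace_mPow {n : ℕ} (hn : 0 < n) (c : ℝ)
    (X Δ : Matrix (Fin n) (Fin n) ℂ) (hX : X.PosDef) (hΔ : Δ.IsHermitian) :
    HasDerivAt (fun t : ℝ => (Matrix.trace (mPow (X + (t : ℂ) • Δ) c)).re)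
      (c * (Matrix.trace (mPow X (c - 1) * Δ)).re) 0 := by
  have : Nonempty (Fin n) := ⟨⟨0, hn⟩⟩
  have hXh := hX.isHermitian
  set D : ℝ := (trace (Δ * Δ)).re
  set μ := hXh.eigenvalues
  obtain ⟨k, hk⟩ := Finite.exists_min μ
  obtain ⟨l, hl⟩ := Finite.exists_max μ
  have hμk : 0 < μ k := hX.eigenvalues_pos k
  obtain ⟨K, hK⟩ := Real.exists_abs_rpow_sub_le c (m := μ k / 2) (M := μ l + μ k / 2)
    (half_pos hμk)
  have hmem : ∀ (j : Fin n) (x : ℝ), |x - μ j| ≤ μ k / 2 →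
      x ∈ Set.Icc (μ k / 2) (μ l + μ k / 2) := fun j x hx => by
    have := abs_le.mp hx
    constructor <;> linarith [hk j, hl j]
  have hsmall : ∀ᶠ t : ℝ in nhds 0, t ^ 2 * D < (μ k / 2) ^ 2 := by
    have : Filter.Tendsto (fun t : ℝ => t ^ 2 * D) (nhds 0) (nhds (0 ^ 2 * D)) :=
      Continuous.tendsto (by fun_prop) 0
    exact this.eventually_lt_const (by simpa using by positivity)
  have hO : (fun t : ℝ => (trace (mPow (X + (t : ℂ) • Δ) c)).re - (trace (mPow X c)).re -
      t * (c * (trace (mPow X (c - 1) * Δ)).re)) =O[nhds 0] fun t : ℝ => t ^ 2 := by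
    refine Asymptotics.IsBigO.of_bound (K * D) ?_
    filter_upwards [hsmall] with t ht
    have hA : (X + (t : ℂ) • Δ).IsHermitian :=
      hXh.add (by simp [IsHermitian, conjTranspose_smul, hΔ.eq])
    set lam := hA.eigenvalues
    set U := hA.eigenvectorUnitary
    set V := hXh.eigenvectorUnitary
    have hdiff : conjDiagonal U lam - conjDiagonal V μ = (t : ℂ) • Δ := by
      rw [← hA.eq_conjDiagonal, ← hXh.eq_conjDiagonal, add_sub_cancel_left]
    have hsq : (trace ((conjDiagonal U lam - conjDiagonal V μ) *
        (conjDiagonal U lam - conjDiagonal V μ))).re = t ^ 2 * D := by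
      rw [hdiff, smul_mul_smul_comm, trace_smul, smul_eq_mul, ← Complex.ofReal_mul,
        Complex.re_ofReal_mul, sq]
    have hlam_mem : ∀ i, lam i ∈ Set.Icc (μ k / 2) (μ l + μ k / 2) := fun i => by
      obtain ⟨j, hj⟩ := exists_sq_sub_le_re_trace U V lam μ i
      rw [hsq] at hj
      exact hmem j _ (abs_le_of_sq_le_sq (hj.trans ht.le) (half_pos hμk).le)
    have hμ_mem : ∀ j, μ j ∈ Set.Icc (μ k / 2) (μ l + μ k / 2) := fun j =>
      hmem j _ (by simpa using (half_pos hμk).le)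
    have hbreg := re_trace_bregman U V lam μ (fun x => x ^ c) (fun x => c * x ^ (c - 1))
    have hlin : conjDiagonal V ((fun x : ℝ => c * x ^ (c - 1)) ∘ μ) =
        (c : ℂ) • mPow X (c - 1) := by
      rw [mPow_eq_conjDiagonal hXh, ← conjDiagonal_smul]
      rfl
    rw [hlin, hdiff, smul_mul_smul_comm, trace_smul, smul_eq_mul, ← Complex.ofReal_mul,
      Complex.re_ofReal_mul, ← mPow_eq_conjDiagonal, ← mPow_eq_conjDiagonal] at hbreg
    rw [show t * (c * (trace (mPow X (c - 1) * Δ)).re) =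
      c * t * (trace (mPow X (c - 1) * Δ)).re by ring, hbreg]
    calc _ ≤ ∑ i, ∑ j, overlap U V i j * (K * (lam i - μ j) ^ 2) := by
          refine (norm_sum_le _ _).trans (Finset.sum_le_sum fun i _ =>
            (norm_sum_le _ _).trans (Finset.sum_le_sum fun j _ => ?_))
          rw [norm_mul, Real.norm_of_nonneg (overlap_nonneg U V i j)]
          exact mul_le_mul_of_nonneg_left (hK _ (hlam_mem i) _ (hμ_mem j))
            (overlap_nonneg U V i j)
      _ = K * (t ^ 2 * D) := by
          rw [← hsq, re_trace_sub_mul_sub]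
          simp only [Finset.mul_sum, mul_left_comm]
      _ = K * D * ‖t ^ 2‖ := by
          rw [Real.norm_of_nonneg (sq_nonneg t)]
          ring
  rw [hasDerivAt_iff_isLittleO]
  simpa using hO.trans_isLittleO (Asymptotics.isLittleO_pow_id one_lt_two)
end

section
/- Let n and ν be positive integers, let Q be an n×n Hermitian positive definite complex matrix, and let M be an n×n Hermitian complex matrix. Then Σ_{l=1}^{ν} tr[Q^l M Q^{ν+1−l} M] is a nonnegative real number, and it equals 0 if and only if M = 0. -/
open Matrix Finset
open scoped ComplexOrder

open scoped MatrixOrder in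
theorem Matrix.PosSemidef.exists_eq_conjTranspose_mul_self {ι 𝕜 : Type*} [Fintype ι] [RCLike 𝕜]
    {A : Matrix ι ι 𝕜} (hA : A.PosSemidef) : ∃ P : Matrix ι ι 𝕜, A = Pᴴ * P := by
  classical
  exact CStarAlgebra.nonneg_iff_eq_star_mul_self.mp hA.nonneg

theorem Matrix.PosSemidef.trace_mul_mul_mul_conjTranspose_nonneg {ι 𝕜 : Type*} [Fintype ι]
    [RCLike 𝕜] {A B : Matrix ι ι 𝕜} (hA : A.PosSemidef) (hB : B.PosSemidef)
    (M : Matrix ι ι 𝕜) : 0 ≤ (A * M * B * Mᴴ).trace := by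
  obtain ⟨P, rfl⟩ := hA.exists_eq_conjTranspose_mul_self
  have h := ((hB.mul_mul_conjTranspose_same M).mul_mul_conjTranspose_same P).trace_nonneg
  rw [trace_mul_comm] at h
  simpa only [Matrix.mul_assoc] using h

theorem Matrix.PosDef.trace_mul_mul_mul_conjTranspose_eq_zero_iff {ι 𝕜 : Type*} [Fintype ι]
    [RCLike 𝕜] {A B : Matrix ι ι 𝕜} (hA : A.PosDef) (hB : B.PosDef) {M : Matrix ι ι 𝕜} :
    (A * M * B * Mᴴ).trace = 0 ↔ M = 0 := by
  classical
  refine ⟨fun h ↦ ?_, fun h ↦ by simp [h]⟩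
  obtain ⟨P, hP⟩ := hA.posSemidef.exists_eq_conjTranspose_mul_self
  obtain ⟨R, hR⟩ := hB.posSemidef.exists_eq_conjTranspose_mul_self
  have hC : P * M * Rᴴ = 0 := by
    rw [← trace_mul_conjTranspose_self_eq_zero_iff, ← h, hP, hR]
    simp only [conjTranspose_mul, conjTranspose_conjTranspose, Matrix.mul_assoc]
    rw [trace_mul_comm Pᴴ]
    simp only [Matrix.mul_assoc]
  have hAMB : A * M * B = 0 := by
    calc A * M * B = Pᴴ * (P * M * Rᴴ) * R := by rw [hP, hR]; simp only [Matrix.mul_assoc]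
      _ = 0 := by simp [hC]
  rwa [hB.isUnit.mul_left_eq_zero, hA.isUnit.mul_right_eq_zero] at hAMB

theorem Matrix.PosDef.pow {ι 𝕜 : Type*} [Fintype ι] [DecidableEq ι] [RCLike 𝕜]
    {A : Matrix ι ι 𝕜} (hA : A.PosDef) (k : ℕ) : (A ^ k).PosDef :=
  (hA.posSemidef.pow k).posDef_iff_isUnit.mpr (hA.isUnit.pow k)

/-- for `Q` Hermitian positive definite and `M` Hermitian,
`Σ_{l=1}^{ν} tr[Q^l M Q^{ν+1−l} M]` is a nonnegative real number, vanishing iff `M = 0`. -/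
theorem sum_trace_quadratic_form_nonneg {n ν : ℕ} (hn : 0 < n) (hν : 0 < ν)
    (Q M : Matrix (Fin n) (Fin n) ℂ) (hQ : Q.PosDef) (hM : M.IsHermitian) :
    (∑ l ∈ Finset.Icc 1 ν, Matrix.trace (Q ^ l * M * Q ^ (ν + 1 - l) * M)).im = 0 ∧
      0 ≤ (∑ l ∈ Finset.Icc 1 ν, Matrix.trace (Q ^ l * M * Q ^ (ν + 1 - l) * M)).re ∧
      ((∑ l ∈ Finset.Icc 1 ν, Matrix.trace (Q ^ l * M * Q ^ (ν + 1 - l) * M)).re = 0 ↔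
        M = 0) := by
  have hnonneg : ∀ l ∈ Finset.Icc 1 ν,
      0 ≤ Matrix.trace (Q ^ l * M * Q ^ (ν + 1 - l) * M) := fun l _ ↦ by
    simpa only [hM.eq] using
      (hQ.pow l).posSemidef.trace_mul_mul_mul_conjTranspose_nonneg
        (hQ.pow (ν + 1 - l)).posSemidef M
  obtain ⟨hre, him⟩ := Complex.nonneg_iff.mp (Finset.sum_nonneg hnonneg)
  refine ⟨him.symm, hre, fun h ↦ ?_, fun h ↦ by simp [h]⟩
  have hsum := (Finset.sum_eq_zero_iff_of_nonneg hnonneg).mp (Complex.ext h him.symm)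
  have hone := hsum 1 (Finset.mem_Icc.mpr ⟨le_rfl, hν⟩)
  refine ((hQ.pow 1).trace_mul_mul_mul_conjTranspose_eq_zero_iff (hQ.pow (ν + 1 - 1))).mp ?_
  rwa [hM.eq]
end

section
/- Let m be a positive integer, let ν be an integer with ν ≥ 2, and let S be an m×m Hermitian complex matrix such that I + ν⁻¹S is positive definite. Define g(P) := (ν²/(1−ν))·tr[P^{(ν−1)/ν}] + ν·tr[P] + tr[S·P] for m×m Hermitian positive definite P, with the matrix power taken via the spectral calculus. Then P° := (I + ν⁻¹S)^{−ν} is the unique minimizer of g over the Hermitian positive definite matrices: for every Hermitian positive definite P ≠ P°, g(P) > g(P°). -/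
open Matrix
open scoped Classical ComplexOrder

/-- The pointwise Lagrangian integrand
`g(P) = (ν²/(1−ν))·tr[P^{(ν−1)/ν}] + ν·tr[P] + tr[S·P]`. -/
noncomputable def gFun {m : ℕ} (ν : ℕ) (S P : Matrix (Fin m) (Fin m) ℂ) : ℝ :=
  ((ν : ℝ) ^ 2 / (1 - (ν : ℝ))) * (Matrix.trace (mPow P (((ν : ℝ) - 1) / (ν : ℝ)))).re +
    (ν : ℝ) * (Matrix.trace P).re + (Matrix.trace (S * P)).re

lemma rpow_neg_div_rpow {n b : ℝ} (hn : 1 < n) (hb : 0 < b) :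
    (b ^ (-n)) ^ ((n - 1) / n) = b * b ^ (-n) := by
  have hn0 : n ≠ 0 := by positivity
  rw [← Real.rpow_mul hb.le, ← Real.rpow_one_add' hb.le (by linarith)]
  congr 1
  field_simp
  ring

lemma scalar_value {n b : ℝ} (hn : 1 < n) (hb : 0 < b) :
    n ^ 2 / (1 - n) * (b ^ (-n)) ^ ((n - 1) / n) + n * (b * b ^ (-n)) =
      n / (1 - n) * (b * b ^ (-n)) := by
  have h1 : 1 - n ≠ 0 := by linarith
  rw [rpow_neg_div_rpow hn hb]
  field_simp
  ring

lemma scalar_lt {n b p : ℝ} (hn : 1 < n) (hb : 0 < b) (hp : 0 < p) (hne : p ≠ b ^ (-n)) :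
    n / (1 - n) * (b * b ^ (-n)) <
      n ^ 2 / (1 - n) * p ^ ((n - 1) / n) + n * (b * p) := by
  have hn0 : n ≠ 0 := by positivity
  have h1 : 0 < n - 1 := by linarith
  set q := p ^ ((n - 1) / n) with hq
  have hq0 : 0 < q := Real.rpow_pos_of_pos hp _
  have hqn : q ^ n = p ^ n / p := by
    rw [hq, ← Real.rpow_mul hp.le, div_mul_cancel₀ _ hn0, Real.rpow_sub_one hp.ne']
  set r := q / (p * b) with hr
  have hr0 : 0 < r := by positivity
  have hrn : r ^ n = b ^ (-n) / p := by
    have hpn : p ^ n ≠ 0 := (Real.rpow_pos_of_pos hp _).ne'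
    have hbn : b ^ n ≠ 0 := (Real.rpow_pos_of_pos hb _).ne'
    rw [hr, Real.div_rpow hq0.le (by positivity), Real.mul_rpow hp.le hb.le, hqn,
      Real.rpow_neg hb.le]
    field_simp
  have hr1 : r - 1 ≠ 0 := by
    intro h
    have h' : r = 1 := by linarith
    rw [h', Real.one_rpow] at hrn
    exact hne ((eq_div_iff hp.ne').mp hrn |>.symm ▸ by ring)
  have key := one_add_mul_self_lt_rpow_one_add (by linarith : -1 ≤ r - 1) hr1 hn
  rw [add_sub_cancel, hrn] at key
  have key2 := mul_lt_mul_of_pos_left key (by positivity : 0 < n / (n - 1) * (p * b))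
  have e1 : n / (n - 1) * (p * b) * (b ^ (-n) / p) = n / (n - 1) * (b * b ^ (-n)) := by
    field_simp
  have e2 : n / (n - 1) * (p * b) * (1 + n * (r - 1)) = n ^ 2 / (n - 1) * q - n * (b * p) := by
    rw [hr]
    field_simp
    ring
  have e3 : ∀ x : ℝ, x / (1 - n) = -(x / (n - 1)) := fun x => by
    rw [← div_neg, neg_sub]
  rw [e1, e2] at key2
  rw [e3, e3]
  linarith

/-- The unitary change of basis between the eigenbases of two Hermitian matrices. -/
noncomputable def eigenOverlap {m : ℕ} {B P : Matrix (Fin m) (Fin m) ℂ}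
    (hB : B.IsHermitian) (hP : P.IsHermitian) : unitaryGroup (Fin m) ℂ :=
  star hB.eigenvectorUnitary * hP.eigenvectorUnitary

lemma sum_normSq_row {m : ℕ} (W : unitaryGroup (Fin m) ℂ) (i : Fin m) :
    ∑ j, Complex.normSq (W.1 i j) = 1 := by
  have h := congrFun (congrFun (mem_unitaryGroup_iff.mp W.2) i) i
  rw [mul_apply, one_apply_eq] at h
  apply Complex.ofReal_injective
  simpa [star_apply, Complex.mul_conj] using h

lemma sum_normSq_col {m : ℕ} (W : unitaryGroup (Fin m) ℂ) (j : Fin m) :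
    ∑ i, Complex.normSq (W.1 i j) = 1 := by
  simpa [star_apply, Complex.normSq_conj] using sum_normSq_row (star W) j

lemma trace_mPow_s13 {m : ℕ} {P : Matrix (Fin m) (Fin m) ℂ} (hP : P.IsHermitian) (τ : ℝ) :
    (mPow P τ).trace = ∑ j, ((hP.eigenvalues j ^ τ : ℝ) : ℂ) := by
  rw [mPow, dif_pos hP, trace_mul_comm, ← mul_assoc,
    Unitary.coe_star_mul_self, one_mul, trace_diagonal]

lemma isHermitian_mPow {m : ℕ} {B : Matrix (Fin m) (Fin m) ℂ} (hB : B.IsHermitian) (τ : ℝ) :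
    (mPow B τ).IsHermitian := by
  rw [mPow, dif_pos hB, star_eq_conjTranspose]
  apply isHermitian_mul_mul_conjTranspose
  exact isHermitian_diagonal_of_self_adjoint _ (by ext i; simp)

lemma spectral_eq {m : ℕ} {P : Matrix (Fin m) (Fin m) ℂ} (hP : P.IsHermitian) :
    P = (hP.eigenvectorUnitary : Matrix (Fin m) (Fin m) ℂ) *
      diagonal (fun i => (hP.eigenvalues i : ℂ)) *
      star (hP.eigenvectorUnitary : Matrix (Fin m) (Fin m) ℂ) := by
  conv_lhs => rw [hP.spectral_theorem]
  rfl

lemma trace_mul_eq_sum {m : ℕ} {B P : Matrix (Fin m) (Fin m) ℂ}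
    (hB : B.IsHermitian) (hP : P.IsHermitian) :
    (B * P).trace.re = ∑ i, ∑ j, Complex.normSq ((eigenOverlap hB hP).1 i j) *
      (hB.eigenvalues i * hP.eigenvalues j) := by
  set W := eigenOverlap hB hP with hW
  have hWc : W.1 = star (hB.eigenvectorUnitary : Matrix (Fin m) (Fin m) ℂ) *
      (hP.eigenvectorUnitary : Matrix (Fin m) (Fin m) ℂ) := rfl
  have h : (B * P).trace = (diagonal (fun i => (hB.eigenvalues i : ℂ)) *
      (W.1 * diagonal (fun i => (hP.eigenvalues i : ℂ)) * star W.1)).trace := by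
    conv_lhs => rw [spectral_eq hB, spectral_eq hP]
    rw [mul_assoc, mul_assoc, trace_mul_comm, hWc, star_mul, star_star]
    simp only [mul_assoc]
  rw [h, trace, Complex.re_sum]
  refine Finset.sum_congr rfl fun i _ => ?_
  rw [diag_apply, diagonal_mul, mul_apply, Finset.mul_sum, Complex.re_sum]
  refine Finset.sum_congr rfl fun j _ => ?_
  rw [mul_diagonal, star_apply]
  have : (hB.eigenvalues i : ℂ) * (W.1 i j * (hP.eigenvalues j : ℂ) * star (W.1 i j)) =
      ((Complex.normSq (W.1 i j) * (hB.eigenvalues i * hP.eigenvalues j) : ℝ) : ℂ) := by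
    push_cast
    rw [← Complex.mul_conj, starRingEnd_apply]
    ring
  rw [this, Complex.ofReal_re]

lemma eq_mPow_iff {m : ℕ} {B P : Matrix (Fin m) (Fin m) ℂ}
    (hB : B.IsHermitian) (hP : P.IsHermitian) (τ : ℝ) :
    P = mPow B τ ↔ ∀ i j, (eigenOverlap hB hP).1 i j ≠ 0 →
      hP.eigenvalues j = hB.eigenvalues i ^ τ := by
  set W := eigenOverlap hB hP with hW
  set U := hP.eigenvectorUnitary with hU
  set V := hB.eigenvectorUnitary with hV
  have hWc : W.1 = star V.1 * U.1 := rfl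
  have hUU : star U.1 * U.1 = 1 := Unitary.coe_star_mul_self U
  have hUU' : U.1 * star U.1 = 1 := Unitary.coe_mul_star_self U
  have hVV : star V.1 * V.1 = 1 := Unitary.coe_star_mul_self V
  have hVV' : V.1 * star V.1 = 1 := Unitary.coe_mul_star_self V
  set D := diagonal (fun i => (hP.eigenvalues i : ℂ)) with hD
  set E := diagonal (fun i => ((hB.eigenvalues i ^ τ : ℝ) : ℂ)) with hE
  have hPs : P = U.1 * D * star U.1 := spectral_eq hP
  have hBs : mPow B τ = V.1 * E * star V.1 := by rw [mPow, dif_pos hB]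
  have hcomm : P = mPow B τ ↔ W.1 * D = E * W.1 := by
    rw [hBs, hWc]
    constructor
    · intro h
      calc star V.1 * U.1 * D = star V.1 * (U.1 * D * star U.1) * U.1 := by
            simp only [mul_assoc, hUU, mul_one]
        _ = star V.1 * (V.1 * E * star V.1) * U.1 := by rw [← hPs, h]
        _ = (star V.1 * V.1) * E * (star V.1 * U.1) := by simp only [mul_assoc]
        _ = _ := by rw [hVV, one_mul]
    · intro h
      calc P = (V.1 * star V.1) * (U.1 * D * star U.1) := by rw [hVV', one_mul, ← hPs]
        _ = V.1 * (star V.1 * U.1 * D) * star U.1 := by simp only [mul_assoc]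
        _ = V.1 * (E * (star V.1 * U.1)) * star U.1 := by rw [h]
        _ = V.1 * E * star V.1 * (U.1 * star U.1) := by simp only [mul_assoc]
        _ = _ := by rw [hUU', mul_one]
  rw [hcomm, ← Matrix.ext_iff]
  refine forall₂_congr fun i j => ?_
  rw [hD, hE, mul_diagonal, diagonal_mul, mul_comm, mul_eq_mul_right_iff, Complex.ofReal_inj]
  tauto

lemma gFun_eq_sum {m : ℕ} (ν : ℕ) (hν : ν ≠ 0) (S : Matrix (Fin m) (Fin m) ℂ)
    {P : Matrix (Fin m) (Fin m) ℂ} (hB : (1 + (ν : ℝ)⁻¹ • S).IsHermitian)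
    (hP : P.IsHermitian) :
    gFun ν S P = ∑ i, ∑ j, Complex.normSq ((eigenOverlap hB hP).1 i j) *
      ((ν : ℝ) ^ 2 / (1 - (ν : ℝ)) * hP.eigenvalues j ^ (((ν : ℝ) - 1) / (ν : ℝ)) +
        (ν : ℝ) * (hB.eigenvalues i * hP.eigenvalues j)) := by
  have hν' : (ν : ℝ) ≠ 0 := by exact_mod_cast hν
  have h1 : (ν : ℝ) * P.trace.re + (S * P).trace.re =
      (ν : ℝ) * ((1 + (ν : ℝ)⁻¹ • S) * P).trace.re := by
    rw [add_mul, one_mul, smul_mul_assoc, trace_add, trace_smul, Complex.add_re,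
      Complex.smul_re, smul_eq_mul]
    field_simp
  have h2 (τ : ℝ) : (mPow P τ).trace.re =
      ∑ i, ∑ j, Complex.normSq ((eigenOverlap hB hP).1 i j) * hP.eigenvalues j ^ τ := by
    rw [trace_mPow_s13 hP, Complex.re_sum, Finset.sum_comm]
    refine Finset.sum_congr rfl fun j _ => ?_
    rw [← Finset.sum_mul, sum_normSq_col, one_mul, Complex.ofReal_re]
  rw [gFun, add_assoc, h1, h2, trace_mul_eq_sum hB hP]
  simp only [Finset.mul_sum, ← Finset.sum_add_distrib]
  refine Finset.sum_congr rfl fun i _ => Finset.sum_congr rfl fun j _ => ?_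
  ring

/-- for an integer `ν ≥ 2` and Hermitian `S` with `I + ν⁻¹S ≻ 0`, the matrix
`P° = (I + ν⁻¹S)^{−ν}` is the unique minimizer of `g` over the Hermitian positive definite
matrices. -/
theorem gFun_unique_minimizer {m : ℕ} (hm : 0 < m) (ν : ℕ) (hν : 2 ≤ ν)
    (S : Matrix (Fin m) (Fin m) ℂ) (hS : S.IsHermitian)
    (hpos : (1 + (ν : ℝ)⁻¹ • S).PosDef) :
    ∀ P : Matrix (Fin m) (Fin m) ℂ, P.PosDef →
      P ≠ mPow (1 + (ν : ℝ)⁻¹ • S) (-(ν : ℝ)) →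
        gFun ν S (mPow (1 + (ν : ℝ)⁻¹ • S) (-(ν : ℝ))) < gFun ν S P := by
  intro P hP hne
  have hn : (1 : ℝ) < ν := by exact_mod_cast hν
  have hν0 : ν ≠ 0 := by omega
  have hB := hpos.isHermitian
  have hb (i) : 0 < hB.eigenvalues i := hpos.eigenvalues_pos i
  have hQ := isHermitian_mPow hB (-(ν : ℝ))
  have hPH := hP.isHermitian
  have hQv := (eq_mPow_iff hB hQ (-(ν : ℝ))).mp rfl
  have hlow (X : Matrix (Fin m) (Fin m) ℂ) (hX : X.IsHermitian) :
      ∑ i, (ν : ℝ) / (1 - ν) * (hB.eigenvalues i * hB.eigenvalues i ^ (-(ν : ℝ))) =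
        ∑ i, ∑ j, Complex.normSq ((eigenOverlap hB hX).1 i j) *
          ((ν : ℝ) / (1 - ν) * (hB.eigenvalues i * hB.eigenvalues i ^ (-(ν : ℝ)))) := by
    refine Finset.sum_congr rfl fun i _ => ?_
    rw [← Finset.sum_mul, sum_normSq_row, one_mul]
  have hmin : gFun ν S (mPow (1 + (ν : ℝ)⁻¹ • S) (-(ν : ℝ))) =
      ∑ i, (ν : ℝ) / (1 - ν) * (hB.eigenvalues i * hB.eigenvalues i ^ (-(ν : ℝ))) := by
    rw [gFun_eq_sum ν hν0 S hB hQ, hlow _ hQ]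
    refine Finset.sum_congr rfl fun i _ => Finset.sum_congr rfl fun j _ => ?_
    by_cases hw : (eigenOverlap hB hQ).1 i j = 0
    · simp only [hw, map_zero, zero_mul]
    · rw [hQv i j hw, scalar_value hn (hb i)]
  have hle (i j) : (ν : ℝ) / (1 - ν) * (hB.eigenvalues i * hB.eigenvalues i ^ (-(ν : ℝ))) ≤
      (ν : ℝ) ^ 2 / (1 - (ν : ℝ)) * hPH.eigenvalues j ^ (((ν : ℝ) - 1) / (ν : ℝ)) +
        (ν : ℝ) * (hB.eigenvalues i * hPH.eigenvalues j) := by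
    by_cases h : hPH.eigenvalues j = hB.eigenvalues i ^ (-(ν : ℝ))
    · rw [h, scalar_value hn (hb i)]
    · exact (scalar_lt hn (hb i) (hP.eigenvalues_pos j) h).le
  rw [Ne, eq_mPow_iff hB hPH] at hne
  push Not at hne
  obtain ⟨i₀, j₀, hw, hv⟩ := hne
  rw [hmin, gFun_eq_sum ν hν0 S hB hPH, hlow P hPH]
  have hterm (i j) := mul_le_mul_of_nonneg_left (hle i j)
    (Complex.normSq_nonneg ((eigenOverlap hB hPH).1 i j))
  refine Finset.sum_lt_sum (fun i _ => Finset.sum_le_sum fun j _ => hterm i j)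
    ⟨i₀, Finset.mem_univ _, Finset.sum_lt_sum (fun j _ => hterm i₀ j)
      ⟨j₀, Finset.mem_univ _, ?_⟩⟩
  exact mul_lt_mul_of_pos_left (scalar_lt hn (hb i₀) (hP.eigenvalues_pos j₀) hv)
    (Complex.normSq_pos.mpr hw)
end

section
/- Let m be a positive integer and τ ∈ ℝ with τ ≠ 0 and τ ≠ 1. Let Φ, Ψ : [0, 2π) → (m×m Hermitian complex matrices) be measurable functions for which there exist constants 0 < c ≤ C with c·I ≤ Φ(θ) ≤ C·I and c·I ≤ Ψ(θ) ≤ C·I for almost every θ, and let W : [0, 2π) → (m×m complex matrices) be a measurable function with W(θ) invertible and W(θ)·W(θ)* = Ψ(θ) for almost every θ. Define S_T^{(τ)}(Φ‖Ψ) := (1/2π)∫₀^{2π} ( tr[(1/(τ(τ−1)))(W(θ)⁻¹Φ(θ)W(θ)⁻*)^τ − (1/(τ−1))Φ(θ)Ψ(θ)⁻¹] + m/τ ) dθ, with matrix powers taken via the spectral calculus. Then S_T^{(τ)}(Φ‖Ψ) ≥ 0, and S_T^{(τ)}(Φ‖Ψ) = 0 if and only if Φ(θ) = Ψ(θ) for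 almost every θ. -/
open Matrix MeasureTheory
open scoped Classical ComplexOrder

/-- The divergence `S_T^{(τ)}(Φ‖Ψ)` between spectral densities on `[0,2π)`, computed with a
pointwise square factor `W` of `Ψ`:
`(1/2π)∫₀^{2π} ( tr[(1/(τ(τ−1)))(W⁻¹ΦW⁻*)^τ − (1/(τ−1))ΦΨ⁻¹] + m/τ ) dθ`. -/
noncomputable def STau {m : ℕ} (τ : ℝ) (Φ Ψ W : ℝ → Matrix (Fin m) (Fin m) ℂ) : ℝ :=
  (1 / (2 * Real.pi)) * ∫ θ in Set.Ico (0 : ℝ) (2 * Real.pi),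
    ((Matrix.trace ((1 / (τ * (τ - 1)) : ℝ) • mPow ((W θ)⁻¹ * Φ θ * ((W θ)ᴴ)⁻¹) τ -
        (1 / (τ - 1) : ℝ) • (Φ θ * (Ψ θ)⁻¹))).re + m / τ)

/-- Bernoulli's inequality for a negative exponent. -/
lemma one_add_mul_sub_one_lt_rpow_of_neg {p x : ℝ} (hp : p < 0) (hx : 0 < x) (hx1 : x ≠ 1) :
    1 + p * (x - 1) < x ^ p := by
  have hy : x⁻¹ - 1 ≠ 0 := by
    rw [sub_ne_zero]
    exact fun h => hx1 (inv_eq_one.mp h)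
  have hy' : -1 ≤ x⁻¹ - 1 := by linarith [inv_pos.mpr hx]
  have h := one_add_mul_self_lt_rpow_one_add hy' hy (p := 1 - p) (by linarith)
  rw [add_sub_cancel, Real.inv_rpow hx.le, ← Real.rpow_neg hx.le, neg_sub,
    Real.rpow_sub_one hx.ne'] at h
  have h2 := mul_lt_mul_of_pos_left h hx
  have e1 : x * (x ^ p / x) = x ^ p := by field_simp
  have e2 : x * (1 + (1 - p) * (x⁻¹ - 1)) = 1 + p * (x - 1) := by field_simp; ring
  rwa [e1, e2] at h2

/-- The scalar generator of the divergence family. -/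
noncomputable def tauEntropy (τ x : ℝ) : ℝ :=
  1 / (τ * (τ - 1)) * x ^ τ - 1 / (τ - 1) * x + 1 / τ

lemma tauEntropy_eq {τ : ℝ} (hτ0 : τ ≠ 0) (hτ1 : τ ≠ 1) (x : ℝ) :
    tauEntropy τ x = (x ^ τ - (1 + τ * (x - 1))) / (τ * (τ - 1)) := by
  have : τ - 1 ≠ 0 := sub_ne_zero.mpr hτ1
  unfold tauEntropy
  field_simp
  ring

lemma tauEntropy_one {τ : ℝ} (hτ0 : τ ≠ 0) (hτ1 : τ ≠ 1) : tauEntropy τ 1 = 0 := by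
  simp [tauEntropy_eq hτ0 hτ1]

lemma tauEntropy_pos {τ x : ℝ} (hτ0 : τ ≠ 0) (hτ1 : τ ≠ 1) (hx : 0 < x) (hx1 : x ≠ 1) :
    0 < tauEntropy τ x := by
  rw [tauEntropy_eq hτ0 hτ1]
  have hs : x - 1 ≠ 0 := sub_ne_zero.mpr hx1
  have hs' : -1 ≤ x - 1 := by linarith
  rcases lt_or_gt_of_ne hτ0 with h0 | h0
  · have := one_add_mul_sub_one_lt_rpow_of_neg h0 hx hx1
    exact div_pos (by linarith) (mul_pos_of_neg_of_neg h0 (by linarith))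
  · rcases lt_or_gt_of_ne hτ1 with h1 | h1
    · have := rpow_one_add_lt_one_add_mul_self hs' hs h0 h1
      rw [add_sub_cancel] at this
      exact div_pos_of_neg_of_neg (by linarith) (mul_neg_of_pos_of_neg h0 (by linarith))
    · have := one_add_mul_self_lt_rpow_one_add hs' hs h1
      rw [add_sub_cancel] at this
      exact div_pos (by linarith) (mul_pos h0 (by linarith))

lemma tauEntropy_nonneg {τ x : ℝ} (hτ0 : τ ≠ 0) (hτ1 : τ ≠ 1) (hx : 0 < x) :
    0 ≤ tauEntropy τ x := by
  rcases eq_or_ne x 1 with rfl | hx1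
  · exact (tauEntropy_one hτ0 hτ1).ge
  · exact (tauEntropy_pos hτ0 hτ1 hx hx1).le

lemma continuousOn_tauEntropy (τ : ℝ) : ContinuousOn (tauEntropy τ) (Set.Ioi 0) := by
  have h : ContinuousOn (fun x : ℝ => x ^ τ) (Set.Ioi 0) := fun x hx =>
    (Real.continuousAt_rpow_const x τ (Or.inl (ne_of_gt hx))).continuousWithinAt
  unfold tauEntropy
  fun_prop

namespace Matrix.IsHermitian

variable {n : ℕ} {A : Matrix (Fin n) (Fin n) ℂ}

lemma eigenvectorBasis_dotProduct_self (hA : A.IsHermitian) (i : Fin n) :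
    star ⇑(hA.eigenvectorBasis i) ⬝ᵥ ⇑(hA.eigenvectorBasis i) = 1 := by
  rw [dotProduct_comm, ← EuclideanSpace.inner_eq_star_dotProduct, inner_self_eq_norm_sq_to_K,
    hA.eigenvectorBasis.orthonormal.1 i]
  simp

lemma le_eigenvalues (hA : A.IsHermitian) {a : ℝ} (h : (A - a • 1).PosSemidef) (i : Fin n) :
    a ≤ hA.eigenvalues i := by
  have h1 := h.re_dotProduct_nonneg ⇑(hA.eigenvectorBasis i)
  rw [sub_mulVec, dotProduct_sub, smul_mulVec, one_mulVec, dotProduct_smul,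
    hA.eigenvectorBasis_dotProduct_self, map_sub, ← hA.eigenvalues_eq] at h1
  simpa using h1

lemma eigenvalues_le (hA : A.IsHermitian) {b : ℝ} (h : (b • 1 - A).PosSemidef) (i : Fin n) :
    hA.eigenvalues i ≤ b := by
  have h1 := h.re_dotProduct_nonneg ⇑(hA.eigenvectorBasis i)
  rw [sub_mulVec, dotProduct_sub, smul_mulVec, one_mulVec, dotProduct_smul,
    hA.eigenvectorBasis_dotProduct_self, map_sub, ← hA.eigenvalues_eq] at h1
  simpa using h1

lemma trace_pow_eq_sum_eigenvalues_pow (hA : A.IsHermitian) (k : ℕ) :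
    (A ^ k).trace = ((∑ i, hA.eigenvalues i ^ k : ℝ) : ℂ) := by
  conv_lhs => rw [hA.spectral_theorem, ← map_pow, Unitary.conjStarAlgAut_apply,
    trace_mul_cycle, Unitary.coe_star_mul_self, one_mul, diagonal_pow, trace_diagonal]
  simp

lemma trace_mPow (hA : A.IsHermitian) (τ : ℝ) :
    (mPow A τ).trace = ((∑ i, hA.eigenvalues i ^ τ : ℝ) : ℂ) := by
  rw [mPow, dif_pos hA, trace_mul_cycle, Unitary.coe_star_mul_self, one_mul, trace_diagonal]
  simp

lemma eq_one_of_eigenvalues_eq_one (hA : A.IsHermitian) (h : ∀ i, hA.eigenvalues i = 1) :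
    A = 1 := by
  have h2 : (RCLike.ofReal ∘ hA.eigenvalues : Fin n → ℂ) = 1 := by
    funext i
    simp [h i]
  rw [hA.spectral_theorem, h2, diagonal_one', map_one]

end Matrix.IsHermitian

/-- The normalized density `W⁻¹ Φ W⁻*`. -/
noncomputable def normalizedDensity {m : ℕ} (P W : Matrix (Fin m) (Fin m) ℂ) :
    Matrix (Fin m) (Fin m) ℂ :=
  W⁻¹ * P * (Wᴴ)⁻¹

lemma normalizedDensity_eq_one_iff {m : ℕ} {P W : Matrix (Fin m) (Fin m) ℂ}
    (hW : IsUnit W.det) : normalizedDensity P W = 1 ↔ P = W * Wᴴ := by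
  have hW' : IsUnit (Wᴴ).det := by
    rw [det_conjTranspose]
    exact hW.star
  unfold normalizedDensity
  constructor
  · intro h
    calc P = W * (W⁻¹ * P * (Wᴴ)⁻¹) * Wᴴ := by
          rw [Matrix.mul_assoc W⁻¹, mul_nonsing_inv_cancel_left _ _ hW,
            nonsing_inv_mul_cancel_right _ _ hW']
      _ = W * Wᴴ := by rw [h, Matrix.mul_one]
  · rintro rfl
    rw [nonsing_inv_mul_cancel_left _ _ hW, mul_nonsing_inv _ hW']

lemma normalizedDensity_posSemidef {m : ℕ} {P : Matrix (Fin m) (Fin m) ℂ} (hP : P.PosSemidef)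
    (W : Matrix (Fin m) (Fin m) ℂ) : (normalizedDensity P W).PosSemidef := by
  rw [normalizedDensity, ← conjTranspose_nonsing_inv]
  exact hP.mul_mul_conjTranspose_same _

/-- A pair of densities with common spectral bounds yields spectral bounds for the normalized
density. -/
lemma normalizedDensity_bounds {m : ℕ} {P Q W : Matrix (Fin m) (Fin m) ℂ} {c C : ℝ}
    (hc : 0 < c) (hcC : c ≤ C) (hP : (P - c • 1).PosSemidef) (hP' : (C • 1 - P).PosSemidef)
    (hQ : (Q - c • 1).PosSemidef) (hQ' : (C • 1 - Q).PosSemidef)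
    (hW : IsUnit W.det) (hWQ : W * Wᴴ = Q) :
    (normalizedDensity P W - (c / C) • 1).PosSemidef ∧
      ((C / c) • 1 - normalizedDensity P W).PosSemidef := by
  have hC : 0 < C := hc.trans_le hcC
  have hQ1 : normalizedDensity Q W = 1 := (normalizedDensity_eq_one_iff hW).mpr hWQ.symm
  constructor
  · have h : (P - (c / C) • Q).PosSemidef := by
      have e : P - (c / C) • Q = (P - c • 1) + (c / C) • (C • 1 - Q) := by
        rw [smul_sub, smul_smul, div_mul_cancel₀ _ hC.ne']
        abel
      rw [e]
      exact hP.add (hQ'.smul (by positivity))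
    have h2 := normalizedDensity_posSemidef h W
    rwa [normalizedDensity, Matrix.mul_sub, Matrix.sub_mul, Matrix.mul_smul, Matrix.smul_mul,
      ← normalizedDensity, ← normalizedDensity, hQ1] at h2
  · have h : ((C / c) • Q - P).PosSemidef := by
      have e : (C / c) • Q - P = (C • 1 - P) + (C / c) • (Q - c • 1) := by
        rw [smul_sub, smul_smul, div_mul_cancel₀ _ hc.ne']
        abel
      rw [e]
      exact hP'.add (hQ.smul (by positivity))
    have h2 := normalizedDensity_posSemidef h W
    rwa [normalizedDensity, Matrix.mul_sub, Matrix.sub_mul, Matrix.mul_smul, Matrix.smul_mul,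
      ← normalizedDensity, ← normalizedDensity, hQ1] at h2

/-- The integrand of the divergence is the sum of the scalar generator over the eigenvalues of the
normalized density. -/
lemma integrand_eq_sum_tauEntropy {m : ℕ} (τ : ℝ) {P Q W : Matrix (Fin m) (Fin m) ℂ}
    (hWQ : W * Wᴴ = Q) (hA : (normalizedDensity P W).IsHermitian) :
    (Matrix.trace ((1 / (τ * (τ - 1)) : ℝ) • mPow (W⁻¹ * P * (Wᴴ)⁻¹) τ -
        (1 / (τ - 1) : ℝ) • (P * Q⁻¹))).re + m / τ =
      ∑ i, tauEntropy τ (hA.eigenvalues i) := by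
  have h1 : (P * Q⁻¹).trace = ((∑ i, hA.eigenvalues i : ℝ) : ℂ) := by
    rw [← hWQ, Matrix.mul_inv_rev, ← Matrix.mul_assoc, trace_mul_comm, ← Matrix.mul_assoc,
      ← normalizedDensity]
    simpa using hA.trace_eq_sum_eigenvalues
  rw [trace_sub, trace_smul, trace_smul, h1, ← normalizedDensity, hA.trace_mPow, Complex.sub_re,
    Complex.smul_re, Complex.smul_re, Complex.ofReal_re, Complex.ofReal_re]
  simp only [tauEntropy, Finset.sum_add_distrib, Finset.sum_sub_distrib, ← Finset.mul_sum]
  simp [div_eq_mul_inv]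

lemma measurable_matrix_entry_comp {α : Type*} [MeasurableSpace α] {m : ℕ}
    {A : α → Matrix (Fin m) (Fin m) ℂ} (hA : ∀ i j, Measurable fun x => A x i j)
    {f : Matrix (Fin m) (Fin m) ℂ → ℂ} (hf : Continuous f) : Measurable fun x => f (A x) := by
  have h : Measurable fun x i j => A x i j :=
    measurable_pi_lambda _ fun i => measurable_pi_lambda _ fun j => hA i j
  have hf' : Continuous (fun B : Fin m → Fin m → ℂ => f B) := hf
  exact hf'.measurable.comp h

lemma measurable_entry_mul {α : Type*} [MeasurableSpace α] {m : ℕ}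
    {A B : α → Matrix (Fin m) (Fin m) ℂ} (hA : ∀ i j, Measurable fun x => A x i j)
    (hB : ∀ i j, Measurable fun x => B x i j) (i j : Fin m) :
    Measurable fun x => (A x * B x) i j := by
  simp only [Matrix.mul_apply]
  exact Finset.measurable_sum _ fun k _ => (hA i k).mul (hB k j)

lemma measurable_entry_inv {α : Type*} [MeasurableSpace α] {m : ℕ}
    {A : α → Matrix (Fin m) (Fin m) ℂ} (hA : ∀ i j, Measurable fun x => A x i j) (i j : Fin m) :
    Measurable fun x => (A x)⁻¹ i j := by
  simp only [Matrix.inv_def, Matrix.smul_apply, Ring.inverse_eq_inv', smul_eq_mul]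
  refine (measurable_matrix_entry_comp hA (f := fun B => B.det) (by fun_prop)).inv.mul ?_
  exact measurable_matrix_entry_comp hA (f := fun B => B.adjugate i j) (by fun_prop)

lemma measurable_entry_normalizedDensity {α : Type*} [MeasurableSpace α] {m : ℕ}
    {P W : α → Matrix (Fin m) (Fin m) ℂ} (hP : ∀ i j, Measurable fun x => P x i j)
    (hW : ∀ i j, Measurable fun x => W x i j) (i j : Fin m) :
    Measurable fun x => normalizedDensity (P x) (W x) i j := by
  refine measurable_entry_mul (measurable_entry_mul (measurable_entry_inv hW) hP)
    (measurable_entry_inv fun i j => ?_) i j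
  exact Complex.continuous_conj.measurable.comp (hW j i)

/-- Traces of continuous functions of a measurable family of Hermitian matrices with spectrum in a
fixed compact interval are measurable. -/
lemma aemeasurable_of_eq_sum_eigenvalues {α : Type*} [MeasurableSpace α] {μ : Measure α} {m : ℕ}
    {A : α → Matrix (Fin m) (Fin m) ℂ} (hA : ∀ i j, Measurable fun x => A x i j) {a b : ℝ}
    {f : ℝ → ℝ} (hf : ContinuousOn f (Set.Icc a b)) {F : α → ℝ}
    (hF : ∀ᵐ x ∂μ, ∃ h : (A x).IsHermitian,
      (∀ i, h.eigenvalues i ∈ Set.Icc a b) ∧ F x = ∑ i, f (h.eigenvalues i)) :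
    AEMeasurable F μ := by
  choose p hp using fun k : ℕ => exists_polynomial_near_of_continuousOn a b f hf
    (1 / ((k : ℝ) + 1)) (by positivity)
  refine aemeasurable_of_tendsto_metrizable_ae Filter.atTop
    (f := fun k x => ∑ d ∈ Finset.range ((p k).natDegree + 1),
      (p k).coeff d * ((A x) ^ d).trace.re) (fun k => ?_) ?_
  · refine (Finset.measurable_sum _ fun d _ => Measurable.const_mul ?_ _).aemeasurable
    exact Complex.measurable_re.comp
      (measurable_matrix_entry_comp hA (f := fun B => (B ^ d).trace) (by fun_prop))
  · filter_upwards [hF] with x hx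
    obtain ⟨h, hmem, hFx⟩ := hx
    have e : ∀ k, ∑ d ∈ Finset.range ((p k).natDegree + 1),
        (p k).coeff d * ((A x) ^ d).trace.re = ∑ i, (p k).eval (h.eigenvalues i) := by
      intro k
      simp only [h.trace_pow_eq_sum_eigenvalues_pow, Complex.ofReal_re, Finset.mul_sum,
        Polynomial.eval_eq_sum_range]
      exact Finset.sum_comm
    simp only [e, hFx]
    refine tendsto_finsetSum _ fun i _ => ?_
    rw [tendsto_iff_dist_tendsto_zero]
    refine squeeze_zero (fun _ => dist_nonneg) (fun k => ?_) tendsto_one_div_add_atTop_nhds_zero_nat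
    rw [Real.dist_eq]
    exact (hp k _ (hmem i)).le

/-- for bounded and coercive spectral densities `Φ, Ψ` and any measurable
pointwise invertible factor `W` with `W·W* = Ψ` a.e., `S_T^{(τ)}(Φ‖Ψ) ≥ 0` with equality iff
`Φ = Ψ` almost everywhere. -/
theorem STau_nonneg_eq_zero_iff {m : ℕ} (hm : 0 < m) (τ : ℝ) (hτ0 : τ ≠ 0) (hτ1 : τ ≠ 1)
    (Φ Ψ W : ℝ → Matrix (Fin m) (Fin m) ℂ)
    (hΦmeas : ∀ i j, Measurable fun θ => Φ θ i j)
    (hΨmeas : ∀ i j, Measurable fun θ => Ψ θ i j)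
    (hWmeas : ∀ i j, Measurable fun θ => W θ i j)
    (c C : ℝ) (hc : 0 < c) (hcC : c ≤ C)
    (hΦbd : ∀ᵐ θ ∂(volume.restrict (Set.Ico (0 : ℝ) (2 * Real.pi))),
      (Φ θ - c • 1).PosSemidef ∧ (C • 1 - Φ θ).PosSemidef)
    (hΨbd : ∀ᵐ θ ∂(volume.restrict (Set.Ico (0 : ℝ) (2 * Real.pi))),
      (Ψ θ - c • 1).PosSemidef ∧ (C • 1 - Ψ θ).PosSemidef)
    (hW : ∀ᵐ θ ∂(volume.restrict (Set.Ico (0 : ℝ) (2 * Real.pi))),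
      IsUnit (W θ).det ∧ W θ * (W θ)ᴴ = Ψ θ) :
    0 ≤ STau τ Φ Ψ W ∧
      (STau τ Φ Ψ W = 0 ↔
        ∀ᵐ θ ∂(volume.restrict (Set.Ico (0 : ℝ) (2 * Real.pi))), Φ θ = Ψ θ) := by
  have hC : 0 < C := hc.trans_le hcC
  set μ := volume.restrict (Set.Ico (0 : ℝ) (2 * Real.pi)) with hμ
  set F : ℝ → ℝ := fun θ =>
    (Matrix.trace ((1 / (τ * (τ - 1)) : ℝ) • mPow ((W θ)⁻¹ * Φ θ * ((W θ)ᴴ)⁻¹) τ -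
      (1 / (τ - 1) : ℝ) • (Φ θ * (Ψ θ)⁻¹))).re + m / τ with hFdef
  have hpi : 0 < 1 / (2 * Real.pi) := by positivity
  have ha : 0 < c / C := by positivity
  have hF : ∀ᵐ θ ∂μ, ∃ h : (normalizedDensity (Φ θ) (W θ)).IsHermitian,
      (∀ i, h.eigenvalues i ∈ Set.Icc (c / C) (C / c)) ∧
        F θ = ∑ i, tauEntropy τ (h.eigenvalues i) := by
    filter_upwards [hΦbd, hΨbd, hW] with θ h1 h2 h3
    obtain ⟨hl, hu⟩ := normalizedDensity_bounds hc hcC h1.1 h1.2 h2.1 h2.2 h3.1 h3.2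
    have hH : (normalizedDensity (Φ θ) (W θ)).IsHermitian := by
      have := hl.isHermitian.add (isHermitian_one.smul (k := c / C) (IsSelfAdjoint.all _))
      simpa using this
    exact ⟨hH, fun i => ⟨hH.le_eigenvalues hl i, hH.eigenvalues_le hu i⟩,
      integrand_eq_sum_tauEntropy τ h3.2 hH⟩
  have hcont : ContinuousOn (tauEntropy τ) (Set.Icc (c / C) (C / c)) :=
    (continuousOn_tauEntropy τ).mono fun x hx => ha.trans_le hx.1
  have hnonneg : 0 ≤ᵐ[μ] F := by
    filter_upwards [hF] with θ hθ
    obtain ⟨h, hmem, e⟩ := hθ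
    rw [e]
    exact Finset.sum_nonneg fun i _ => tauEntropy_nonneg hτ0 hτ1 (ha.trans_le (hmem i).1)
  have hint : Integrable F μ := by
    obtain ⟨K, hK⟩ := isCompact_Icc.exists_bound_of_continuousOn hcont
    refine Integrable.of_bound (C := ∑ _i : Fin m, K) (aemeasurable_of_eq_sum_eigenvalues
      (measurable_entry_normalizedDensity hΦmeas hWmeas) hcont hF).aestronglyMeasurable ?_
    filter_upwards [hF] with θ hθ
    obtain ⟨h, hmem, e⟩ := hθ
    rw [e]
    exact norm_sum_le_of_le _ fun i _ => hK _ (hmem i)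
  have hS : STau τ Φ Ψ W = 1 / (2 * Real.pi) * ∫ θ, F θ ∂μ := rfl
  refine ⟨hS ▸ mul_nonneg hpi.le (integral_nonneg_of_ae hnonneg), ?_⟩
  rw [hS, mul_eq_zero, or_iff_right hpi.ne', integral_eq_zero_iff_of_nonneg_ae hnonneg hint]
  refine Filter.eventually_congr ?_
  filter_upwards [hF, hW] with θ hθ hWθ
  obtain ⟨h, hmem, e⟩ := hθ
  rw [e, ← hWθ.2, ← normalizedDensity_eq_one_iff hWθ.1, Pi.zero_apply,
    Finset.sum_eq_zero_iff_of_nonneg fun i _ =>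
      tauEntropy_nonneg hτ0 hτ1 (ha.trans_le (hmem i).1)]
  constructor
  · refine fun h0 => h.eq_one_of_eigenvalues_eq_one fun i => ?_
    by_contra hne
    exact (tauEntropy_pos hτ0 hτ1 (ha.trans_le (hmem i).1) hne).ne' (h0 i (Finset.mem_univ i))
  · intro h1 i _
    have e1 : h.eigenvalues i = 1 := le_antisymm
      (h.eigenvalues_le (by simpa [h1] using PosSemidef.zero) i)
      (h.le_eigenvalues (by simpa [h1] using PosSemidef.zero) i)
    rw [e1, tauEntropy_one hτ0 hτ1]
end

section
/- Let m be a positive integer and τ ∈ (0,1). Let Ψ : [0, 2π) → (m×m Hermitian complex matrices) be measurable with c·I ≤ Ψ(θ) ≤ C·I almost everywhere for some constants 0 < c ≤ C, and let W : [0, 2π) → (m×m complex matrices) be measurable with W(θ) invertible and W(θ)·W(θ)* = Ψ(θ) almost everywhere. For measurable Φ with c'·I ≤ Φ(θ) ≤ C'·I almost everywhere (for some 0 < c' ≤ C') define S_T^{(τ)}(Φ‖Ψ) := (1/2π)∫₀^{2π} ( tr[(1/(τ(τ−1)))(W(θ)⁻¹Φ(θ)W(θ)⁻*)^τ − (1/(τ−1))Φ(θ)Ψ(θ)⁻¹]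 + m/τ ) dθ. Then Φ ↦ S_T^{(τ)}(Φ‖Ψ) is strictly convex: if Φ₀ and Φ₁ are two such spectral densities that differ on a set of positive measure and λ ∈ (0,1), then S_T^{(τ)}(λΦ₀ + (1−λ)Φ₁‖Ψ) < λ·S_T^{(τ)}(Φ₀‖Ψ) + (1−λ)·S_T^{(τ)}(Φ₁‖Ψ). -/
open Matrix MeasureTheory
open scoped Classical ComplexOrder

namespace Real

/-- The tangent line of the strictly concave function `x ↦ x ^ p` lies strictly above its graph
away from the point of tangency. -/
lemma rpow_lt_tangent {p x y : ℝ} (hp₀ : 0 < p) (hp₁ : p < 1) (hx : 0 ≤ x) (hy : 0 < y)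
    (hxy : x ≠ y) : x ^ p < y ^ p + p * y ^ (p - 1) * (x - y) := by
  have h := rpow_one_add_lt_one_add_mul_self (s := x / y - 1)
    (by have := div_nonneg hx hy.le; linarith)
    (by rw [sub_ne_zero, Ne, div_eq_one_iff_eq hy.ne']; exact hxy) hp₀ hp₁
  rw [add_sub_cancel, div_rpow hx hy.le, div_lt_iff₀ (rpow_pos_of_pos hy p)] at h
  refine h.trans_eq ?_
  rw [rpow_sub_one hy.ne']
  field_simp

lemma rpow_le_tangent {p x y : ℝ} (hp₀ : 0 < p) (hp₁ : p < 1) (hx : 0 ≤ x) (hy : 0 < y) :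
    x ^ p ≤ y ^ p + p * y ^ (p - 1) * (x - y) := by
  by_cases hxy : x = y
  · simp [hxy]
  · exact (rpow_lt_tangent hp₀ hp₁ hx hy hxy).le

end Real

section Trace

variable {n : ℕ}

lemma trace_unitary_conj (U : unitary (Matrix (Fin n) (Fin n) ℂ)) (D : Matrix (Fin n) (Fin n) ℂ) :
    ((U : Matrix (Fin n) (Fin n) ℂ) * D * (star U : Matrix (Fin n) (Fin n) ℂ)).trace
      = D.trace := by
  rw [Matrix.trace_mul_cycle, Unitary.coe_star_mul_self, one_mul]

lemma Matrix.IsHermitian.eq_conj_diagonal {A : Matrix (Fin n) (Fin n) ℂ} (hA : A.IsHermitian) :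
    A = (hA.eigenvectorUnitary : Matrix (Fin n) (Fin n) ℂ) *
      Matrix.diagonal (fun i => (hA.eigenvalues i : ℂ)) *
      (star hA.eigenvectorUnitary : Matrix (Fin n) (Fin n) ℂ) := by
  conv_lhs => rw [hA.spectral_theorem, Unitary.conjStarAlgAut_apply]
  rfl

lemma trace_mPow_re {A : Matrix (Fin n) (Fin n) ℂ} (hA : A.IsHermitian) (τ : ℝ) :
    (mPow A τ).trace.re = ∑ i, hA.eigenvalues i ^ τ := by
  rw [mPow, dif_pos hA, trace_unitary_conj, Matrix.trace_diagonal]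
  simp only [Complex.re_sum, Complex.ofReal_re]

lemma trace_re_eq_sum_eigenvalues {A : Matrix (Fin n) (Fin n) ℂ} (hA : A.IsHermitian) :
    A.trace.re = ∑ i, hA.eigenvalues i := by
  rw [hA.trace_eq_sum_eigenvalues]
  simp

lemma trace_pow_re {A : Matrix (Fin n) (Fin n) ℂ} (hA : A.IsHermitian) (k : ℕ) :
    (A ^ k).trace.re = ∑ i, hA.eigenvalues i ^ k := by
  have h : A ^ k = Unitary.conjStarAlgAut ℂ _ hA.eigenvectorUnitary
      (Matrix.diagonal (fun i => ((hA.eigenvalues i ^ k : ℝ) : ℂ))) := by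
    conv_lhs => rw [hA.spectral_theorem]
    rw [← map_pow, Matrix.diagonal_pow]
    congr 2
    ext i
    simp
  rw [h, Unitary.conjStarAlgAut_apply, trace_unitary_conj, Matrix.trace_diagonal]
  simp only [Complex.re_sum, Complex.ofReal_re]

/-- The trace of a product of two spectral decompositions, in terms of the transition
probabilities between the two eigenbases. -/
lemma trace_mul_conj_diagonal_re (U V : unitary (Matrix (Fin n) (Fin n) ℂ)) (d e : Fin n → ℝ) :
    (((U : Matrix (Fin n) (Fin n) ℂ) * Matrix.diagonal (fun i => (d i : ℂ)) *
        (star U : Matrix (Fin n) (Fin n) ℂ)) *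
      ((V : Matrix (Fin n) (Fin n) ℂ) * Matrix.diagonal (fun i => (e i : ℂ)) *
        (star V : Matrix (Fin n) (Fin n) ℂ))).trace.re =
      ∑ i, ∑ j, d i * e j *
        Complex.normSq ((star U * V : unitary (Matrix (Fin n) (Fin n) ℂ)).1 i j) := by
  set Q := (star U * V : unitary (Matrix (Fin n) (Fin n) ℂ)).1 with hQ
  have hQ' : Q = (star U : Matrix (Fin n) (Fin n) ℂ) * (V : Matrix (Fin n) (Fin n) ℂ) := rfl
  have hQs : Qᴴ = (star V : Matrix (Fin n) (Fin n) ℂ) * (U : Matrix (Fin n) (Fin n) ℂ) := by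
    rw [hQ', ← Matrix.star_eq_conjTranspose, star_mul, star_star]
  have h : (((U : Matrix (Fin n) (Fin n) ℂ) * Matrix.diagonal (fun i => (d i : ℂ)) *
        (star U : Matrix (Fin n) (Fin n) ℂ)) *
      ((V : Matrix (Fin n) (Fin n) ℂ) * Matrix.diagonal (fun i => (e i : ℂ)) *
        (star V : Matrix (Fin n) (Fin n) ℂ))).trace =
      (Matrix.diagonal (fun i => (d i : ℂ)) *
        (Q * Matrix.diagonal (fun i => (e i : ℂ)) * Qᴴ)).trace := by
    rw [hQs, hQ', Matrix.mul_assoc, Matrix.mul_assoc, Matrix.trace_mul_comm]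
    simp only [Matrix.mul_assoc]
  rw [h, Matrix.trace, Complex.re_sum]
  refine Finset.sum_congr rfl fun i _ => ?_
  rw [Matrix.diag_apply, Matrix.diagonal_mul, Matrix.mul_apply, Finset.mul_sum, Complex.re_sum]
  refine Finset.sum_congr rfl fun j _ => ?_
  rw [Matrix.mul_diagonal, Matrix.conjTranspose_apply]
  have : (d i : ℂ) * (Q i j * (e j : ℂ) * star (Q i j)) =
      ((d i * e j * Complex.normSq (Q i j) : ℝ) : ℂ) := by
    push_cast
    rw [← Complex.mul_conj]
    simp only [Complex.star_def]
    ring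
  rw [this, Complex.ofReal_re]

lemma sum_normSq_row_s16 (Q : unitary (Matrix (Fin n) (Fin n) ℂ)) (i : Fin n) :
    ∑ j, Complex.normSq (Q.1 i j) = 1 := by
  have h := congrFun (congrFun (Unitary.coe_mul_star_self Q) i) i
  rw [Unitary.coe_star, Matrix.star_eq_conjTranspose, Matrix.mul_apply, Matrix.one_apply_eq] at h
  simp only [Matrix.conjTranspose_apply, Complex.star_def, Complex.mul_conj] at h
  exact_mod_cast h

lemma sum_normSq_col_s16 (Q : unitary (Matrix (Fin n) (Fin n) ℂ)) (j : Fin n) :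
    ∑ i, Complex.normSq (Q.1 i j) = 1 := by
  have h := congrFun (congrFun (Unitary.coe_star_mul_self Q) j) j
  rw [Matrix.star_eq_conjTranspose, Matrix.mul_apply, Matrix.one_apply_eq] at h
  simp only [Matrix.conjTranspose_apply, Complex.star_def, mul_comm _ (Q.1 _ j),
    Complex.mul_conj] at h
  exact_mod_cast h

/-- Klein's inequality for `x ↦ x ^ τ`, with its equality case: the trace of the `τ`-th power
lies strictly below a supporting real-linear functional away from the point of tangency. -/
lemma exists_trace_mPow_tangent {τ : ℝ} (hτ : τ ∈ Set.Ioo (0 : ℝ) 1)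
    {B : Matrix (Fin n) (Fin n) ℂ} (hB : B.PosDef) :
    ∃ L : Matrix (Fin n) (Fin n) ℂ →ₗ[ℝ] ℝ, ∀ A : Matrix (Fin n) (Fin n) ℂ, A.PosSemidef →
      (mPow A τ).trace.re ≤ (mPow B τ).trace.re + L (A - B) ∧
      ((mPow A τ).trace.re = (mPow B τ).trace.re + L (A - B) → A = B) := by
  have hBh := hB.isHermitian
  set U := hBh.eigenvectorUnitary with hU
  set b := hBh.eigenvalues with hb
  have hbpos : ∀ i, 0 < b i := hB.eigenvalues_pos
  set d : Fin n → ℝ := fun i => τ * b i ^ (τ - 1) with hd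
  set G : Matrix (Fin n) (Fin n) ℂ := (U : Matrix (Fin n) (Fin n) ℂ) *
    Matrix.diagonal (fun i => (d i : ℂ)) * (star U : Matrix (Fin n) (Fin n) ℂ) with hG
  have hBeq : B = (U : Matrix (Fin n) (Fin n) ℂ) * Matrix.diagonal (fun i => (b i : ℂ)) *
    (star U : Matrix (Fin n) (Fin n) ℂ) := hBh.eq_conj_diagonal
  have hGB : (G * B).trace.re = ∑ i, d i * b i := by
    rw [hBeq, hG, trace_mul_conj_diagonal_re]
    refine Finset.sum_congr rfl fun i _ => ?_
    rw [Unitary.star_mul_self, Finset.sum_eq_single i]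
    · simp
    · intro j _ hj
      simp [Matrix.one_apply_ne hj.symm]
    · simp
  refine ⟨{ toFun := fun X => (G * X).trace.re
            map_add' := fun X Y => by simp [mul_add]
            map_smul' := fun r X => by simp }, fun A hA => ?_⟩
  have hAh := hA.isHermitian
  set V := hAh.eigenvectorUnitary with hV
  set a := hAh.eigenvalues with ha
  have hapos : ∀ i, 0 ≤ a i := hA.eigenvalues_nonneg
  have hAeq : A = (V : Matrix (Fin n) (Fin n) ℂ) * Matrix.diagonal (fun i => (a i : ℂ)) *
    (star V : Matrix (Fin n) (Fin n) ℂ) := hAh.eq_conj_diagonal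
  set Q : unitary (Matrix (Fin n) (Fin n) ℂ) := star U * V with hQ
  have hGA : (G * A).trace.re = ∑ i, ∑ j, d i * a j * Complex.normSq (Q.1 i j) := by
    conv_lhs => rw [hAeq, hG, trace_mul_conj_diagonal_re]
  set t : Fin n → Fin n → ℝ := fun i j =>
    Complex.normSq (Q.1 i j) * (b i ^ τ + d i * (a j - b i) - a j ^ τ) with ht
  have ht0 : ∀ i j, 0 ≤ t i j := fun i j => mul_nonneg (Complex.normSq_nonneg _)
    (sub_nonneg.2 (Real.rpow_le_tangent hτ.1 hτ.2 (hapos j) (hbpos i)))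
  have hrow (f : Fin n → ℝ) : ∑ i, ∑ j, f i * Complex.normSq (Q.1 i j) = ∑ i, f i := by
    simp only [← Finset.mul_sum, sum_normSq_row_s16, mul_one]
  have hcol (f : Fin n → ℝ) : ∑ i, ∑ j, f j * Complex.normSq (Q.1 i j) = ∑ i, f i := by
    rw [Finset.sum_comm]
    simp only [← Finset.mul_sum, sum_normSq_col_s16, mul_one]
  have hsum : (mPow B τ).trace.re + (G * (A - B)).trace.re - (mPow A τ).trace.re =
      ∑ i, ∑ j, t i j := by
    rw [mul_sub, Matrix.trace_sub, Complex.sub_re, hGA, hGB, trace_mPow_re hAh,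
      trace_mPow_re hBh, ← hrow fun i => hBh.eigenvalues i ^ τ,
      ← hcol fun i => hAh.eigenvalues i ^ τ, ← hrow fun i => d i * b i]
    simp only [← Finset.sum_add_distrib, ← Finset.sum_sub_distrib]
    refine Finset.sum_congr rfl fun i _ => Finset.sum_congr rfl fun j _ => ?_
    simp only [ht]
    ring
  have hsum0 : 0 ≤ ∑ i, ∑ j, t i j :=
    Finset.sum_nonneg fun i _ => Finset.sum_nonneg fun j _ => ht0 i j
  simp only [LinearMap.coe_mk, AddHom.coe_mk]
  refine ⟨by linarith, fun heq => ?_⟩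
  have hz : ∑ i, ∑ j, t i j = 0 := by rw [← hsum]; linarith
  have hz' : ∀ i j, t i j = 0 := fun i j => by
    have h1 := (Finset.sum_eq_zero_iff_of_nonneg
      (fun i _ => Finset.sum_nonneg fun j _ => ht0 i j)).1 hz i (Finset.mem_univ _)
    exact (Finset.sum_eq_zero_iff_of_nonneg (fun j _ => ht0 i j)).1 h1 j (Finset.mem_univ _)
  have hcomm : Matrix.diagonal (fun i => (b i : ℂ)) * Q.1 =
      Q.1 * Matrix.diagonal (fun i => (a i : ℂ)) := by
    ext i j
    rw [Matrix.diagonal_mul, Matrix.mul_diagonal, mul_comm]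
    rcases mul_eq_zero.1 (hz' i j) with h | h
    · rw [Complex.normSq_eq_zero.1 h, zero_mul, zero_mul]
    · by_cases hab : a j = b i
      · rw [hab]
      · exact absurd h (sub_pos.2
          (Real.rpow_lt_tangent hτ.1 hτ.2 (hapos j) (hbpos i) hab)).ne'
  have hUQ : (U : Matrix (Fin n) (Fin n) ℂ) * Q.1 = V := by
    change (U : Matrix (Fin n) (Fin n) ℂ) * ((star U : Matrix (Fin n) (Fin n) ℂ) * V.1) = V
    rw [← mul_assoc, Unitary.mul_star_self_of_mem U.2, one_mul]
  have hQV : Q.1 * (star V : Matrix (Fin n) (Fin n) ℂ) = (star U : Matrix (Fin n) (Fin n) ℂ) := by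
    change ((star U : Matrix (Fin n) (Fin n) ℂ) * V.1) * (star V : Matrix (Fin n) (Fin n) ℂ) = _
    rw [mul_assoc, Unitary.mul_star_self_of_mem V.2, mul_one]
  calc A = (U : Matrix (Fin n) (Fin n) ℂ) * (Q.1 * Matrix.diagonal (fun i => (a i : ℂ))) *
        (star V : Matrix (Fin n) (Fin n) ℂ) := by rw [← mul_assoc, hUQ, ← hAeq]
    _ = B := by
      rw [← hcomm]
      conv_rhs => rw [hBeq, ← hQV]
      simp only [mul_assoc]

/-- Strict concavity of `A ↦ tr (A ^ τ)` on positive definite matrices. -/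
lemma trace_mPow_concave {τ lam : ℝ} (hτ : τ ∈ Set.Ioo (0 : ℝ) 1) (hlam : lam ∈ Set.Ioo (0 : ℝ) 1)
    {A₀ A₁ : Matrix (Fin n) (Fin n) ℂ} (h₀ : A₀.PosDef) (h₁ : A₁.PosDef) :
    lam * (mPow A₀ τ).trace.re + (1 - lam) * (mPow A₁ τ).trace.re ≤
        (mPow (lam • A₀ + (1 - lam) • A₁) τ).trace.re ∧
      (lam * (mPow A₀ τ).trace.re + (1 - lam) * (mPow A₁ τ).trace.re =
        (mPow (lam • A₀ + (1 - lam) • A₁) τ).trace.re → A₀ = A₁) := by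
  have hl' : 0 < 1 - lam := sub_pos.2 hlam.2
  set B := lam • A₀ + (1 - lam) • A₁ with hB
  have hBpos : B.PosDef := (h₀.smul hlam.1).add (h₁.smul hl')
  obtain ⟨L, hL⟩ := exists_trace_mPow_tangent hτ hBpos
  obtain ⟨h0, h0'⟩ := hL A₀ h₀.posSemidef
  obtain ⟨h1, h1'⟩ := hL A₁ h₁.posSemidef
  have hLB : lam * L (A₀ - B) + (1 - lam) * L (A₁ - B) = 0 := by
    rw [← smul_eq_mul, ← smul_eq_mul, ← map_smul, ← map_smul, ← map_add]
    convert map_zero L using 2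
    rw [hB]
    module
  have e0 := mul_le_mul_of_nonneg_left h0 hlam.1.le
  have e1 := mul_le_mul_of_nonneg_left h1 hl'.le
  refine ⟨by nlinarith, fun heq => ?_⟩
  have f0 : A₀ = B := h0' (mul_left_cancel₀ hlam.1.ne' (by nlinarith))
  have f1 : A₁ = B := h1' (mul_left_cancel₀ hl'.ne' (by nlinarith))
  rw [f0, ← f1]

end Trace

section Measurability

variable {α : Type*} [MeasurableSpace α] {n : ℕ}

lemma measurable_matrix_mul_apply {F G : α → Matrix (Fin n) (Fin n) ℂ}
    (hF : ∀ i j, Measurable fun x => F x i j) (hG : ∀ i j, Measurable fun x => G x i j)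
    (i j : Fin n) : Measurable fun x => (F x * G x) i j := by
  simp only [Matrix.mul_apply]
  exact Finset.measurable_sum _ fun k _ => (hF i k).mul (hG k j)

lemma measurable_matrix_pow_apply {F : α → Matrix (Fin n) (Fin n) ℂ}
    (hF : ∀ i j, Measurable fun x => F x i j) (k : ℕ) :
    ∀ i j, Measurable fun x => (F x ^ k) i j := by
  induction k with
  | zero => intro i j; simp
  | succ k ih => simpa only [pow_succ] using measurable_matrix_mul_apply ih hF

lemma measurable_matrix_conjTranspose_apply {F : α → Matrix (Fin n) (Fin n) ℂ}
    (hF : ∀ i j, Measurable fun x => F x i j) (i j : Fin n) :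
    Measurable fun x => (F x)ᴴ i j :=
  (Complex.continuous_conj.measurable).comp (hF j i)

lemma measurable_matrix_det {F : α → Matrix (Fin n) (Fin n) ℂ}
    (hF : ∀ i j, Measurable fun x => F x i j) : Measurable fun x => (F x).det := by
  simp only [Matrix.det_apply']
  exact Finset.measurable_sum _ fun σ _ =>
    measurable_const.mul (Finset.measurable_prod _ fun i _ => hF (σ i) i)

lemma measurable_matrix_inv_apply {F : α → Matrix (Fin n) (Fin n) ℂ}
    (hF : ∀ i j, Measurable fun x => F x i j) (i j : Fin n) :
    Measurable fun x => (F x)⁻¹ i j := by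
  simp only [Matrix.inv_def, Matrix.smul_apply, Ring.inverse_eq_inv', smul_eq_mul,
    Matrix.adjugate_apply]
  refine (measurable_matrix_det hF).inv.mul (measurable_matrix_det fun k l => ?_)
  by_cases hk : k = j
  · simp [hk]
  · simpa [Matrix.updateRow_ne hk] using hF k l

lemma measurable_matrix_trace {F : α → Matrix (Fin n) (Fin n) ℂ}
    (hF : ∀ i j, Measurable fun x => F x i j) : Measurable fun x => (F x).trace :=
  Finset.measurable_sum _ fun i _ => hF i i

lemma aemeasurable_trace_mPow {μ : Measure α} {F : α → Matrix (Fin n) (Fin n) ℂ} {τ : ℝ}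
    (hτ : 0 < τ) (hF : ∀ i j, Measurable fun x => F x i j) (hpos : ∀ᵐ x ∂μ, (F x).PosSemidef) :
    AEMeasurable (fun x => (mPow (F x) τ).trace.re) μ := by
  have hp (k : ℕ) : ∃ p : Polynomial ℝ, ∀ x ∈ Set.Icc (0 : ℝ) k,
      |p.eval x - x ^ τ| < 1 / ((k : ℝ) + 1) :=
    exists_polynomial_near_of_continuousOn 0 k _
      (Real.continuous_rpow_const hτ.le).continuousOn _ (by positivity)
  choose p hp using hp
  refine aemeasurable_of_tendsto_metrizable_ae Filter.atTop
    (f := fun k x => ∑ l ∈ Finset.range ((p k).natDegree + 1), (p k).coeff l *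
      (F x ^ l).trace.re)
    (fun k => (Finset.measurable_sum _ fun l _ => measurable_const.mul
      (Complex.measurable_re.comp
        (measurable_matrix_trace (measurable_matrix_pow_apply hF l)))).aemeasurable) ?_
  filter_upwards [hpos] with x hx
  have hh := hx.isHermitian
  have heq (k : ℕ) : ∑ l ∈ Finset.range ((p k).natDegree + 1), (p k).coeff l *
      (F x ^ l).trace.re = ∑ i, (p k).eval (hh.eigenvalues i) := by
    simp only [trace_pow_re hh, Polynomial.eval_eq_sum_range, Finset.mul_sum]
    exact Finset.sum_comm
  simp only [heq, trace_mPow_re hh]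
  refine tendsto_finsetSum _ fun i _ => ?_
  rw [tendsto_iff_dist_tendsto_zero]
  refine squeeze_zero' (.of_forall fun _ => dist_nonneg) ?_ tendsto_one_div_add_atTop_nhds_zero_nat
  obtain ⟨N, hN⟩ := exists_nat_ge (hh.eigenvalues i)
  filter_upwards [Filter.eventually_ge_atTop N] with k hk
  exact (hp k _ ⟨hx.eigenvalues_nonneg i, hN.trans (by exact_mod_cast hk)⟩).le

lemma integrable_trace_mPow {μ : Measure α} [IsFiniteMeasure μ]
    {F : α → Matrix (Fin n) (Fin n) ℂ} {τ K : ℝ} (hτ : τ ∈ Set.Ioo (0 : ℝ) 1)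
    (hF : ∀ i j, Measurable fun x => F x i j) (hpos : ∀ᵐ x ∂μ, (F x).PosSemidef)
    (hK : ∀ᵐ x ∂μ, (F x).trace.re ≤ K) :
    Integrable (fun x => (mPow (F x) τ).trace.re) μ := by
  refine Integrable.of_bound (aemeasurable_trace_mPow hτ.1 hF hpos).aestronglyMeasurable
    (n + K) ?_
  filter_upwards [hpos, hK] with x hx hxK
  have hh := hx.isHermitian
  rw [trace_re_eq_sum_eigenvalues hh] at hxK
  have hnn := hx.eigenvalues_nonneg
  rw [trace_mPow_re hh, Real.norm_of_nonneg
    (Finset.sum_nonneg fun i _ => Real.rpow_nonneg (hnn i) τ)]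
  calc ∑ i, hh.eigenvalues i ^ τ ≤ ∑ i, (1 + hh.eigenvalues i) := by
        refine Finset.sum_le_sum fun i _ => ?_
        have := Real.rpow_le_tangent hτ.1 hτ.2 (hnn i) one_pos
        simp only [Real.one_rpow, mul_one] at this
        nlinarith [hnn i, hτ.1, hτ.2, mul_nonneg (hnn i) (sub_nonneg.2 hτ.2.le)]
    _ ≤ n + K := by
        rw [Finset.sum_add_distrib]
        simpa using hxK

lemma integrable_trace_re {μ : Measure α} [IsFiniteMeasure μ]
    {F : α → Matrix (Fin n) (Fin n) ℂ} {K : ℝ}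
    (hF : ∀ i j, Measurable fun x => F x i j) (hpos : ∀ᵐ x ∂μ, (F x).PosSemidef)
    (hK : ∀ᵐ x ∂μ, (F x).trace.re ≤ K) :
    Integrable (fun x => (F x).trace.re) μ := by
  refine Integrable.of_bound
    (Complex.measurable_re.comp (measurable_matrix_trace hF)).aestronglyMeasurable K ?_
  filter_upwards [hpos, hK] with x hx hxK
  rwa [Real.norm_of_nonneg (Complex.nonneg_iff.1 hx.trace_nonneg).1]

end Measurability

section Normalization

variable {n : ℕ} {Φ Ψ W : Matrix (Fin n) (Fin n) ℂ}

lemma posDef_of_sub_smul_one {c : ℝ} (hc : 0 < c) (h : (Φ - c • 1).PosSemidef) : Φ.PosDef := by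
  simpa using Matrix.PosDef.posSemidef_add h (Matrix.PosDef.one.smul hc)

lemma posSemidef_normalized (W : Matrix (Fin n) (Fin n) ℂ) (hΦ : Φ.PosSemidef) :
    (W⁻¹ * Φ * Wᴴ⁻¹).PosSemidef := by
  rw [← Matrix.conjTranspose_nonsing_inv]
  exact hΦ.mul_mul_conjTranspose_same _

lemma posDef_normalized (hW : IsUnit W.det) (hΦ : Φ.PosDef) : (W⁻¹ * Φ * Wᴴ⁻¹).PosDef := by
  rw [← Matrix.conjTranspose_nonsing_inv, ← Matrix.star_eq_conjTranspose]
  exact (Matrix.IsUnit.posDef_star_right_conjugate_iff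
    (by rw [Matrix.isUnit_nonsing_inv_iff, Matrix.isUnit_iff_isUnit_det]; exact hW)).2 hΦ

lemma isUnit_det_conjTranspose (hW : IsUnit W.det) : IsUnit Wᴴ.det := by
  rw [Matrix.det_conjTranspose]
  exact hW.star

lemma normalized_injective (hW : IsUnit W.det) {Φ' : Matrix (Fin n) (Fin n) ℂ}
    (h : W⁻¹ * Φ * Wᴴ⁻¹ = W⁻¹ * Φ' * Wᴴ⁻¹) : Φ = Φ' := by
  have key (X : Matrix (Fin n) (Fin n) ℂ) : W * (W⁻¹ * X * Wᴴ⁻¹) * Wᴴ = X := by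
    rw [← mul_assoc, ← mul_assoc, Matrix.mul_nonsing_inv _ hW, one_mul,
      Matrix.nonsing_inv_mul_cancel_right _ _ (isUnit_det_conjTranspose hW)]
  rw [← key Φ, h, key]

lemma trace_mul_inv_eq_trace_normalized (hΨ : W * Wᴴ = Ψ) :
    (Φ * Ψ⁻¹).trace = (W⁻¹ * Φ * Wᴴ⁻¹).trace := by
  rw [← hΨ, Matrix.mul_inv_rev, ← mul_assoc, Matrix.trace_mul_comm, mul_assoc]

lemma trace_normalized_le {c C : ℝ} (hc : 0 < c) (hC : 0 ≤ C) (hW : IsUnit W.det)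
    (hΨ : W * Wᴴ = Ψ) (hΨc : (Ψ - c • 1).PosSemidef) (hΦC : (C • 1 - Φ).PosSemidef) :
    (W⁻¹ * Φ * Wᴴ⁻¹).trace.re ≤ C * (n / c) := by
  have h1 := (Complex.nonneg_iff.1 (posSemidef_normalized W hΨc).trace_nonneg).1
  have h2 := (Complex.nonneg_iff.1 (posSemidef_normalized W hΦC).trace_nonneg).1
  have hone : W⁻¹ * Ψ * Wᴴ⁻¹ = 1 := by
    rw [← hΨ, Matrix.nonsing_inv_mul_cancel_left _ _ hW,
      Matrix.mul_nonsing_inv _ (isUnit_det_conjTranspose hW)]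
  rw [mul_sub, sub_mul, hone] at h1
  rw [mul_sub, sub_mul] at h2
  simp only [mul_smul_comm, smul_mul_assoc, mul_one, Matrix.trace_sub, Matrix.trace_smul,
    Complex.sub_re, Complex.smul_re, smul_eq_mul, Matrix.trace_one, Fintype.card_fin,
    Complex.natCast_re] at h1 h2
  have h3 : (W⁻¹ * Wᴴ⁻¹).trace.re ≤ n / c := by
    rw [le_div_iff₀ hc]; linarith
  nlinarith [mul_le_mul_of_nonneg_left h3 hC]

end Normalization

/-- The divergence in terms of the traces of the normalized density `W⁻¹ Φ W⁻*`. -/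
lemma STau_eq {m : ℕ} {τ : ℝ} {Φ Ψ W : ℝ → Matrix (Fin m) (Fin m) ℂ}
    (hW : ∀ᵐ θ ∂(volume.restrict (Set.Ico (0 : ℝ) (2 * Real.pi))), W θ * (W θ)ᴴ = Ψ θ) :
    STau τ Φ Ψ W = (1 / (2 * Real.pi)) * ∫ θ in Set.Ico (0 : ℝ) (2 * Real.pi),
      ((1 / (τ * (τ - 1)) * (mPow ((W θ)⁻¹ * Φ θ * ((W θ)ᴴ)⁻¹) τ).trace.re -
        1 / (τ - 1) * ((W θ)⁻¹ * Φ θ * ((W θ)ᴴ)⁻¹).trace.re) + m / τ) := by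
  rw [STau]
  congr 1
  refine integral_congr_ae ?_
  filter_upwards [hW] with θ hθ
  rw [Matrix.trace_sub, Matrix.trace_smul, Matrix.trace_smul,
    trace_mul_inv_eq_trace_normalized hθ]
  simp only [Complex.sub_re, Complex.smul_re, smul_eq_mul]

/-- for `τ ∈ (0,1)`, the map `Φ ↦ S_T^{(τ)}(Φ‖Ψ)` is strictly convex on the
bounded and coercive spectral densities: if `Φ₀` and `Φ₁` differ on a set of positive measure
and `λ ∈ (0,1)`, then `S_T^{(τ)}(λΦ₀+(1−λ)Φ₁‖Ψ) < λ S_T^{(τ)}(Φ₀‖Ψ) + (1−λ) S_T^{(τ)}(Φ₁‖Ψ)`. -/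
theorem STau_strictConvex {m : ℕ} (hm : 0 < m) (τ : ℝ) (hτ : τ ∈ Set.Ioo (0 : ℝ) 1)
    (Ψ W : ℝ → Matrix (Fin m) (Fin m) ℂ)
    (hΨmeas : ∀ i j, Measurable fun θ => Ψ θ i j)
    (hWmeas : ∀ i j, Measurable fun θ => W θ i j)
    (c C : ℝ) (hc : 0 < c) (hcC : c ≤ C)
    (hΨbd : ∀ᵐ θ ∂(volume.restrict (Set.Ico (0 : ℝ) (2 * Real.pi))),
      (Ψ θ - c • 1).PosSemidef ∧ (C • 1 - Ψ θ).PosSemidef)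
    (hW : ∀ᵐ θ ∂(volume.restrict (Set.Ico (0 : ℝ) (2 * Real.pi))),
      IsUnit (W θ).det ∧ W θ * (W θ)ᴴ = Ψ θ)
    (Φ₀ Φ₁ : ℝ → Matrix (Fin m) (Fin m) ℂ)
    (hΦ₀meas : ∀ i j, Measurable fun θ => Φ₀ θ i j)
    (hΦ₁meas : ∀ i j, Measurable fun θ => Φ₁ θ i j)
    (c₀ C₀ : ℝ) (hc₀ : 0 < c₀) (hcC₀ : c₀ ≤ C₀)
    (hΦ₀bd : ∀ᵐ θ ∂(volume.restrict (Set.Ico (0 : ℝ) (2 * Real.pi))),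
      (Φ₀ θ - c₀ • 1).PosSemidef ∧ (C₀ • 1 - Φ₀ θ).PosSemidef)
    (c₁ C₁ : ℝ) (hc₁ : 0 < c₁) (hcC₁ : c₁ ≤ C₁)
    (hΦ₁bd : ∀ᵐ θ ∂(volume.restrict (Set.Ico (0 : ℝ) (2 * Real.pi))),
      (Φ₁ θ - c₁ • 1).PosSemidef ∧ (C₁ • 1 - Φ₁ θ).PosSemidef)
    (hne : ¬ (∀ᵐ θ ∂(volume.restrict (Set.Ico (0 : ℝ) (2 * Real.pi))), Φ₀ θ = Φ₁ θ))
    (lam : ℝ) (hlam : lam ∈ Set.Ioo (0 : ℝ) 1) :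
    STau τ (fun θ => lam • Φ₀ θ + (1 - lam) • Φ₁ θ) Ψ W <
      lam * STau τ Φ₀ Ψ W + (1 - lam) * STau τ Φ₁ Ψ W := by
  set μ := volume.restrict (Set.Ico (0 : ℝ) (2 * Real.pi)) with hμ
  have hW' : ∀ᵐ θ ∂μ, W θ * (W θ)ᴴ = Ψ θ := hW.mono fun _ h => h.2
  have hl' : 0 < 1 - lam := sub_pos.2 hlam.2
  rw [STau_eq hW', STau_eq hW', STau_eq hW']
  have hAmeas {Φ : ℝ → Matrix (Fin m) (Fin m) ℂ} (hΦ : ∀ i j, Measurable fun θ => Φ θ i j) :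
      ∀ i j, Measurable fun θ => ((W θ)⁻¹ * Φ θ * ((W θ)ᴴ)⁻¹) i j :=
    measurable_matrix_mul_apply
      (measurable_matrix_mul_apply (measurable_matrix_inv_apply hWmeas) hΦ)
      (measurable_matrix_inv_apply (measurable_matrix_conjTranspose_apply hWmeas))
  have hint {Φ : ℝ → Matrix (Fin m) (Fin m) ℂ} (hΦ : ∀ i j, Measurable fun θ => Φ θ i j)
      {c' C' : ℝ} (hc' : 0 < c') (hcC' : c' ≤ C')
      (hbd : ∀ᵐ θ ∂μ, (Φ θ - c' • 1).PosSemidef ∧ (C' • 1 - Φ θ).PosSemidef) :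
      Integrable (fun θ => (1 / (τ * (τ - 1)) * (mPow ((W θ)⁻¹ * Φ θ * ((W θ)ᴴ)⁻¹) τ).trace.re -
        1 / (τ - 1) * ((W θ)⁻¹ * Φ θ * ((W θ)ᴴ)⁻¹).trace.re) + m / τ) μ := by
    have hpos : ∀ᵐ θ ∂μ, ((W θ)⁻¹ * Φ θ * ((W θ)ᴴ)⁻¹).PosSemidef := by
      filter_upwards [hbd] with θ h
      exact posSemidef_normalized _ (posDef_of_sub_smul_one hc' h.1).posSemidef
    have hK : ∀ᵐ θ ∂μ, ((W θ)⁻¹ * Φ θ * ((W θ)ᴴ)⁻¹).trace.re ≤ C' * (m / c) := by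
      filter_upwards [hbd, hΨbd, hW] with θ h hΨ hWθ
      exact trace_normalized_le hc (hc'.le.trans hcC') hWθ.1 hWθ.2 hΨ.1 h.2
    exact (((integrable_trace_mPow hτ (hAmeas hΦ) hpos hK).const_mul _).sub
      ((integrable_trace_re (hAmeas hΦ) hpos hK).const_mul _)).add (integrable_const _)
  have hi₀ := hint hΦ₀meas hc₀ hcC₀ hΦ₀bd
  have hi₁ := hint hΦ₁meas hc₁ hcC₁ hΦ₁bd
  have hi := hint (Φ := fun θ => lam • Φ₀ θ + (1 - lam) • Φ₁ θ)
    (fun i j => ((hΦ₀meas i j).const_smul lam).add ((hΦ₁meas i j).const_smul (1 - lam)))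
    (c' := lam * c₀ + (1 - lam) * c₁) (C' := lam * C₀ + (1 - lam) * C₁)
    (add_pos (mul_pos hlam.1 hc₀) (mul_pos hl' hc₁))
    (add_le_add (mul_le_mul_of_nonneg_left hcC₀ hlam.1.le)
      (mul_le_mul_of_nonneg_left hcC₁ hl'.le)) (by
      filter_upwards [hΦ₀bd, hΦ₁bd] with θ h₀ h₁
      constructor
      · convert (h₀.1.smul hlam.1.le).add (h₁.1.smul hl'.le) using 1
        module
      · convert (h₀.2.smul hlam.1.le).add (h₁.2.smul hl'.le) using 1
        module)
  set g₀ := fun θ => (1 / (τ * (τ - 1)) * (mPow ((W θ)⁻¹ * Φ₀ θ * ((W θ)ᴴ)⁻¹) τ).trace.re -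
    1 / (τ - 1) * ((W θ)⁻¹ * Φ₀ θ * ((W θ)ᴴ)⁻¹).trace.re) + m / τ with hg₀
  set g₁ := fun θ => (1 / (τ * (τ - 1)) * (mPow ((W θ)⁻¹ * Φ₁ θ * ((W θ)ᴴ)⁻¹) τ).trace.re -
    1 / (τ - 1) * ((W θ)⁻¹ * Φ₁ θ * ((W θ)ᴴ)⁻¹).trace.re) + m / τ with hg₁
  set g := fun θ => (1 / (τ * (τ - 1)) *
      (mPow ((W θ)⁻¹ * (lam • Φ₀ θ + (1 - lam) • Φ₁ θ) * ((W θ)ᴴ)⁻¹) τ).trace.re -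
    1 / (τ - 1) * ((W θ)⁻¹ * (lam • Φ₀ θ + (1 - lam) • Φ₁ θ) * ((W θ)ᴴ)⁻¹).trace.re) + m / τ
    with hg
  have hk : 1 / (τ * (τ - 1)) < 0 :=
    one_div_neg.2 (mul_neg_of_pos_of_neg hτ.1 (sub_neg.2 hτ.2))
  have hptwise : ∀ᵐ θ ∂μ, 0 ≤ lam * g₀ θ + (1 - lam) * g₁ θ - g θ ∧
      (lam * g₀ θ + (1 - lam) * g₁ θ - g θ = 0 → Φ₀ θ = Φ₁ θ) := by
    filter_upwards [hΦ₀bd, hΦ₁bd, hW] with θ h₀ h₁ hWθ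
    obtain ⟨hle, heq⟩ := trace_mPow_concave hτ hlam
      (posDef_normalized hWθ.1 (posDef_of_sub_smul_one hc₀ h₀.1))
      (posDef_normalized hWθ.1 (posDef_of_sub_smul_one hc₁ h₁.1))
    have hsplit : (W θ)⁻¹ * (lam • Φ₀ θ + (1 - lam) • Φ₁ θ) * ((W θ)ᴴ)⁻¹ =
        lam • ((W θ)⁻¹ * Φ₀ θ * ((W θ)ᴴ)⁻¹) + (1 - lam) • ((W θ)⁻¹ * Φ₁ θ * ((W θ)ᴴ)⁻¹) := by
      simp only [mul_add, add_mul, mul_smul_comm, smul_mul_assoc]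
    have hgap : lam * g₀ θ + (1 - lam) * g₁ θ - g θ = 1 / (τ * (τ - 1)) *
        (lam * (mPow ((W θ)⁻¹ * Φ₀ θ * ((W θ)ᴴ)⁻¹) τ).trace.re +
          (1 - lam) * (mPow ((W θ)⁻¹ * Φ₁ θ * ((W θ)ᴴ)⁻¹) τ).trace.re -
          (mPow (lam • ((W θ)⁻¹ * Φ₀ θ * ((W θ)ᴴ)⁻¹) +
            (1 - lam) • ((W θ)⁻¹ * Φ₁ θ * ((W θ)ᴴ)⁻¹)) τ).trace.re) := by
      simp only [hg, hg₀, hg₁, hsplit, Matrix.trace_add, Matrix.trace_smul, Complex.add_re,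
        Complex.smul_re, smul_eq_mul]
      ring
    rw [hgap]
    refine ⟨mul_nonneg_of_nonpos_of_nonpos hk.le (sub_nonpos.2 hle), fun h => ?_⟩
    exact normalized_injective hWθ.1
      (heq (sub_eq_zero.1 ((mul_eq_zero.1 h).resolve_left hk.ne)))
  have hgi : Integrable (fun θ => lam * g₀ θ + (1 - lam) * g₁ θ - g θ) μ :=
    ((hi₀.const_mul lam).add (hi₁.const_mul (1 - lam))).sub hi
  have hintegral : ∫ θ, (lam * g₀ θ + (1 - lam) * g₁ θ - g θ) ∂μ =
      lam * ∫ θ, g₀ θ ∂μ + (1 - lam) * ∫ θ, g₁ θ ∂μ - ∫ θ, g θ ∂μ := by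
    rw [integral_sub (f := fun θ => lam * g₀ θ + (1 - lam) * g₁ θ)
        ((hi₀.const_mul lam).add (hi₁.const_mul (1 - lam))) hi,
      integral_add (hi₀.const_mul lam) (hi₁.const_mul (1 - lam)),
      integral_const_mul, integral_const_mul]
  have hnn : 0 ≤ᵐ[μ] fun θ => lam * g₀ θ + (1 - lam) * g₁ θ - g θ :=
    hptwise.mono fun _ h => h.1
  have hlt : 0 < ∫ θ, (lam * g₀ θ + (1 - lam) * g₁ θ - g θ) ∂μ := by
    refine (integral_nonneg_of_ae hnn).lt_of_ne fun h => hne ?_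
    filter_upwards [hptwise, (integral_eq_zero_iff_of_nonneg_ae hnn hgi).1 h.symm] with θ h₁ h₂
    exact h₁.2 h₂
  rw [hintegral] at hlt
  have hpi : 0 < 1 / (2 * Real.pi) := by positivity
  nlinarith [mul_pos hpi hlt]
end
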